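/- arXiv:1407.5559 — 3 statements merged into one kernel-verified Lean document; each statement's English description precedes it below -/
import Mathlib

section
/- Let n ≥ 1 and 0 < α < 2. There exists a constant C_{n,α} > 0, depending only on n and α, such that for every Schwartz function ψ on ℝⁿ the principal-value integral Lψ(x) = lim_{ε→0⁺} ∫_{{z : |x-z| > ε}} (ψ(x) - ψ(z))/|x-z|^{n+α} dz exists for every x, and the Fourier transform satisfies F(C_{n,α} Lψ)(ξ) = |ξ|^α F(ψ)(ξ) for every ξ ∈ ℝⁿ. -/
open MeasureTheory Filter Topology Metric FourierTransform

noncomputable section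

/-- Principal-value fractional Laplacian (without normalizing constant). -/
def IsFracLapAt (n : ℕ) (α : ℝ) (φ : EuclideanSpace ℝ (Fin n) → ℝ)
    (x : EuclideanSpace ℝ (Fin n)) (L : ℝ) : Prop :=
  Tendsto (fun ε : ℝ =>
      ∫ z in {z : EuclideanSpace ℝ (Fin n) | ε < ‖x - z‖},
        (φ x - φ z) / ‖x - z‖ ^ ((n : ℝ) + α))
    (𝓝[>] 0) (𝓝 L)


section SecondDifference

open Module Set Real

/-- The centred second difference of `f` at `x` with step `y`. -/
def secondDiff {V : Type*} [AddGroup V] (f : V → ℝ) (x y : V) : ℝ := 2 * f x - f (x + y) - f (x - y)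

lemma continuous_secondDiff {V : Type*} [NormedAddCommGroup V] {f : V → ℝ} (hf : Continuous f) :
    Continuous (fun p : V × V => secondDiff f p.1 p.2) := by
  unfold secondDiff
  fun_prop

variable {V : Type*} [NormedAddCommGroup V] [InnerProductSpace ℝ V]

/-- Near the diagonal the second difference of a Schwartz function is quadratic in the step,
with a constant that decays rapidly in the base point. -/
lemma exists_abs_secondDiff_le_decay (ψ : SchwartzMap V ℝ) (k : ℕ) :
    ∃ M : ℝ, 0 ≤ M ∧ ∀ x y : V, ‖y‖ ≤ 1 →
      |secondDiff ψ x y| ≤ M * ((1 + ‖x‖) ^ k)⁻¹ * ‖y‖ ^ 2 := by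
  set g : SchwartzMap V (V →L[ℝ] ℝ) := SchwartzMap.fderivCLM ℝ V ℝ ψ
  set h : SchwartzMap V (V →L[ℝ] V →L[ℝ] ℝ) := SchwartzMap.fderivCLM ℝ V (V →L[ℝ] ℝ) g
  obtain ⟨A, hA0, hA⟩ : ∃ A : ℝ, 0 ≤ A ∧ ∀ z, (1 + ‖z‖) ^ k * ‖h z‖ ≤ A := by
    refine ⟨_, ?_, fun z => by
      simpa using SchwartzMap.one_add_le_sup_seminorm_apply (𝕜 := ℝ) (m := (k, 0)) (k := k)
        (n := 0) le_rfl le_rfl h z⟩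
    positivity
  refine ⟨2 * (2 ^ k * A), by positivity, fun x y hy => ?_⟩
  set B := 2 ^ k * A * ((1 + ‖x‖) ^ k)⁻¹ with hB
  have hB0 : 0 ≤ B := by positivity
  have hbound : ∀ z ∈ closedBall x ‖y‖, ‖fderiv ℝ g z‖ ≤ B := by
    intro z hz
    have hz' : ‖z - x‖ ≤ 1 := (mem_closedBall_iff_norm.1 hz).trans hy
    have hxz : 1 + ‖x‖ ≤ 2 * (1 + ‖z‖) := by
      have := norm_sub_norm_le x z
      rw [norm_sub_rev] at this
      linarith [norm_nonneg z]
    have hpow : (1 + ‖x‖) ^ k ≤ 2 ^ k * (1 + ‖z‖) ^ k := by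
      rw [← mul_pow]
      gcongr
    rw [show fderiv ℝ g z = h z from rfl, hB, ← div_eq_mul_inv, le_div_iff₀ (by positivity)]
    calc ‖h z‖ * (1 + ‖x‖) ^ k ≤ ‖h z‖ * (2 ^ k * (1 + ‖z‖) ^ k) := by gcongr
      _ = 2 ^ k * ((1 + ‖z‖) ^ k * ‖h z‖) := by ring
      _ ≤ 2 ^ k * A := by gcongr; exact hA z
  have hgrad : ∀ a ∈ closedBall x ‖y‖, ∀ b ∈ closedBall x ‖y‖, ‖g b - g a‖ ≤ B * ‖b - a‖ :=
    fun a ha b hb => (convex_closedBall x ‖y‖).norm_image_sub_le_of_norm_fderiv_le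
      (fun z _ => g.differentiableAt) hbound ha hb
  have hder : ∀ w : V, HasFDerivAt (fun w => ψ (x + w) + ψ (x - w)) (g (x + w) - g (x - w)) w := by
    intro w
    have h1 : HasFDerivAt (fun w => ψ (x + w)) (g (x + w)) w :=
      (hasFDerivAt_comp_add_left x).2 (ψ.differentiableAt.hasFDerivAt)
    have h2 : HasFDerivAt (fun w => ψ (x - w)) (-g (x - w)) w := by
      refine ((ψ.differentiableAt (x := x - w)).hasFDerivAt.comp w
        ((hasFDerivAt_id w).const_sub x)).congr_fderiv ?_
      ext v
      simp [g]
    exact (h1.add h2).congr_fderiv (sub_eq_add_neg _ _).symm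
  have hmv := (convex_closedBall (0 : V) ‖y‖).norm_image_sub_le_of_norm_hasFDerivWithin_le
    (C := B * (2 * ‖y‖)) (x := 0) (y := y)
    (fun w _ => (hder w).hasFDerivWithinAt) (fun w hw => ?_) (by simp) (by simp)
  · have : |secondDiff ψ x y| = ‖ψ (x + y) + ψ (x - y) - (ψ (x + 0) + ψ (x - 0))‖ := by
      rw [← norm_neg, Real.norm_eq_abs, secondDiff]
      congr 1
      simp
      ring
    rw [this]
    refine hmv.trans (le_of_eq ?_)
    rw [sub_zero, hB]
    ring
  · have hw' : ‖w‖ ≤ ‖y‖ := by simpa using hw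
    refine (hgrad (x - w) (by simpa using hw') (x + w) (by simpa using hw')).trans ?_
    gcongr
    rw [show x + w - (x - w) = (2 : ℝ) • w by rw [two_smul]; abel, norm_smul]
    simpa using hw'

lemma schwartz_exists_abs_le (ψ : SchwartzMap V ℝ) : ∃ M : ℝ, 0 ≤ M ∧ ∀ x, |ψ x| ≤ M :=
  ⟨SchwartzMap.seminorm ℝ 0 0 ψ, apply_nonneg _ _, SchwartzMap.norm_le_seminorm ℝ ψ⟩

lemma exists_abs_secondDiff_le (ψ : SchwartzMap V ℝ) :
    ∃ M : ℝ, ∀ x y : V, |secondDiff ψ x y| ≤ M * min 1 (‖y‖ ^ 2) := by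
  obtain ⟨A, hA0, hA⟩ := exists_abs_secondDiff_le_decay ψ 0
  obtain ⟨S, hS0, hS⟩ := schwartz_exists_abs_le ψ
  refine ⟨A + 4 * S, fun x y => ?_⟩
  rcases le_total ‖y‖ 1 with hy | hy
  · rw [min_eq_right (pow_le_one₀ (norm_nonneg y) hy)]
    refine (hA x y hy).trans ?_
    simp only [pow_zero, inv_one, mul_one]
    gcongr
    linarith
  · rw [min_eq_left (one_le_pow₀ hy), mul_one, secondDiff, abs_le]
    have h1 := abs_le.1 (hS x)
    have h2 := abs_le.1 (hS (x + y))
    have h3 := abs_le.1 (hS (x - y))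
    constructor <;> linarith [h1.1, h1.2, h2.1, h2.2, h3.1, h3.2]

variable [FiniteDimensional ℝ V] [MeasurableSpace V] [BorelSpace V]

/-- The weight `min(1, |y|²) / |y|^(d + α)` is integrable on a `d`-dimensional space. -/
lemma integrable_min_one_sq_div_norm_rpow [Nontrivial V] {α : ℝ} (hα0 : 0 < α) (hα2 : α < 2) :
    Integrable (fun y : V => min 1 (‖y‖ ^ 2) / ‖y‖ ^ ((finrank ℝ V : ℝ) + α)) := by
  rw [integrable_fun_norm_addHaar volume
    (f := fun r : ℝ => min 1 (r ^ 2) / r ^ ((finrank ℝ V : ℝ) + α))]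
  have key : ∀ r : ℝ, 0 < r → r ^ (finrank ℝ V - 1) •
      (min 1 (r ^ 2) / r ^ ((finrank ℝ V : ℝ) + α)) = min 1 (r ^ 2) * r ^ (-1 - α) := by
    intro r hr
    have h1 : 1 ≤ finrank ℝ V := Module.finrank_pos
    rw [← Real.rpow_natCast r (finrank ℝ V - 1), smul_eq_mul, div_eq_mul_inv,
      ← Real.rpow_neg hr.le, mul_left_comm, ← Real.rpow_add hr]
    push_cast [h1]
    congr 2
    ring
  rw [← Ioc_union_Ioi_eq_Ioi (zero_le_one' ℝ)]
  refine IntegrableOn.union ?_ ?_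
  · rw [integrableOn_congr_fun (g := fun r : ℝ => r ^ (1 - α)) _ measurableSet_Ioc]
    · rw [integrableOn_Ioc_iff_integrableOn_Ioo]
      exact (intervalIntegral.integrableOn_Ioo_rpow_iff zero_lt_one).2 (by linarith)
    · intro r hr
      simp only
      rw [key r hr.1, min_eq_right (pow_le_one₀ hr.1.le hr.2), ← Real.rpow_natCast r 2,
        ← Real.rpow_add hr.1]
      congr 1
      push_cast
      ring
  · rw [integrableOn_congr_fun (g := fun r : ℝ => r ^ (-1 - α)) _ measurableSet_Ioi]
    · exact integrableOn_Ioi_rpow_of_lt (by linarith) zero_lt_one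
    · intro r hr
      have hr' : (1 : ℝ) < r := hr
      simp only
      rw [key r (by linarith), min_eq_left (one_le_pow₀ hr'.le), one_mul]

lemma integrable_secondDiff_left (ψ : SchwartzMap V ℝ) (y : V) :
    Integrable (fun x => secondDiff ψ x y) :=
  ((ψ.integrable.const_mul 2).sub (ψ.integrable.comp_add_right y)).sub
    (ψ.integrable.comp_sub_right y)

lemma exists_integral_abs_secondDiff_le (ψ : SchwartzMap V ℝ) :
    ∃ M : ℝ, ∀ y : V, ∫ x, |secondDiff ψ x y| ≤ M * min 1 (‖y‖ ^ 2) := by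
  obtain ⟨A, hA0, hA⟩ := exists_abs_secondDiff_le_decay ψ (finrank ℝ V + 1)
  have hI : Integrable (fun x : V => ((1 + ‖x‖) ^ (finrank ℝ V + 1))⁻¹) := by
    have := integrable_one_add_norm (E := V) (μ := volume) (r := ((finrank ℝ V + 1 : ℕ) : ℝ))
      (by simp)
    refine this.congr (Eventually.of_forall fun x => ?_)
    simp only
    rw [Real.rpow_neg (by positivity), Real.rpow_natCast]
  set J := ∫ x : V, ((1 + ‖x‖) ^ (finrank ℝ V + 1))⁻¹
  have hJ0 : 0 ≤ J := integral_nonneg fun x => by positivity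
  set N := ∫ x, |ψ x|
  have hN0 : 0 ≤ N := integral_nonneg fun x => by positivity
  refine ⟨A * J + 4 * N, fun y => ?_⟩
  have hint := (integrable_secondDiff_left ψ y).abs
  rcases le_total ‖y‖ 1 with hy | hy
  · rw [min_eq_right (pow_le_one₀ (norm_nonneg y) hy)]
    calc ∫ x, |secondDiff ψ x y|
        ≤ ∫ x, A * ((1 + ‖x‖) ^ (finrank ℝ V + 1))⁻¹ * ‖y‖ ^ 2 :=
          integral_mono hint ((hI.const_mul A).mul_const _) fun x => hA x y hy
      _ = A * J * ‖y‖ ^ 2 := by rw [integral_mul_const, integral_const_mul]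
      _ ≤ _ := by gcongr; linarith
  · rw [min_eq_left (one_le_pow₀ hy), mul_one]
    have i0 := ψ.integrable (μ := volume).abs
    calc ∫ x, |secondDiff ψ x y|
        ≤ ∫ x, (2 * |ψ x| + |ψ (x + y)| + |ψ (x - y)|) := by
          refine integral_mono hint (((i0.const_mul 2).add (i0.comp_add_right y)).add
            (i0.comp_sub_right y)) fun x => ?_
          simp only [secondDiff]
          refine (abs_sub _ _).trans (add_le_add_left ((abs_sub _ _).trans ?_) _)
          rw [abs_mul, abs_two]
      _ = 4 * N := by
          have i1 : Integrable fun x => 2 * |ψ x| + |ψ (x + y)| :=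
            (i0.const_mul 2).add (i0.comp_add_right y)
          rw [integral_add i1 (i0.comp_sub_right y),
            integral_add (i0.const_mul 2) (i0.comp_add_right y), integral_const_mul,
            integral_add_right_eq_self (fun x => |ψ x|) y,
            integral_sub_right_eq_self (fun x => |ψ x|) y]
          ring
      _ ≤ _ := by linarith [mul_nonneg hA0 hJ0]

lemma integrable_secondDiff_div_right [Nontrivial V] {α : ℝ} (hα0 : 0 < α) (hα2 : α < 2)
    (ψ : SchwartzMap V ℝ) (x : V) :
    Integrable (fun y => secondDiff ψ x y / ‖y‖ ^ ((finrank ℝ V : ℝ) + α)) := by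
  obtain ⟨M, hM⟩ := exists_abs_secondDiff_le ψ
  refine ((integrable_min_one_sq_div_norm_rpow (V := V) hα0 hα2).const_mul M).mono' ?_
    (Eventually.of_forall fun y => ?_)
  · have := (continuous_secondDiff ψ.continuous).comp (Continuous.prodMk_right x)
    exact (this.measurable.div (by fun_prop)).aestronglyMeasurable
  · rw [norm_div, Real.norm_eq_abs, Real.norm_of_nonneg (by positivity), ← mul_div_assoc]
    gcongr
    exact hM x y

lemma integrable_secondDiff_div_prod [Nontrivial V] {α : ℝ} (hα0 : 0 < α) (hα2 : α < 2)
    (ψ : SchwartzMap V ℝ) :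
    Integrable (fun p : V × V => secondDiff ψ p.1 p.2 / ‖p.2‖ ^ ((finrank ℝ V : ℝ) + α))
      (volume.prod volume) := by
  obtain ⟨M, hM⟩ := exists_integral_abs_secondDiff_le ψ
  have hmeas : Measurable
      (fun p : V × V => secondDiff ψ p.1 p.2 / ‖p.2‖ ^ ((finrank ℝ V : ℝ) + α)) :=
    (continuous_secondDiff ψ.continuous).measurable.div (by fun_prop)
  rw [integrable_prod_iff' hmeas.aestronglyMeasurable]
  refine ⟨Eventually.of_forall fun y => by
    simpa using (integrable_secondDiff_left ψ y).div_const (‖y‖ ^ ((finrank ℝ V : ℝ) + α)), ?_⟩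
  refine ((integrable_min_one_sq_div_norm_rpow (V := V) hα0 hα2).const_mul M).mono' ?_
    (Eventually.of_forall fun y => ?_)
  · exact (hmeas.norm.stronglyMeasurable.integral_prod_left').aestronglyMeasurable
  · rw [Real.norm_of_nonneg (integral_nonneg fun x => norm_nonneg _)]
    simp_rw [norm_div, Real.norm_eq_abs]
    rw [integral_div, abs_of_nonneg (by positivity : 0 ≤ ‖y‖ ^ ((finrank ℝ V : ℝ) + α)),
      ← mul_div_assoc]
    gcongr
    exact hM y

/-- The symmetrised integral that computes the principal value. -/
lemma tendsto_principalValue_secondDiff [Nontrivial V] {α : ℝ} (hα0 : 0 < α) (hα2 : α < 2)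
    (ψ : SchwartzMap V ℝ) (x : V) :
    Tendsto (fun ε : ℝ => ∫ z in {z : V | ε < ‖x - z‖},
        (ψ x - ψ z) / ‖x - z‖ ^ ((finrank ℝ V : ℝ) + α)) (𝓝[>] 0)
      (𝓝 (2⁻¹ * ∫ y, secondDiff ψ x y / ‖y‖ ^ ((finrank ℝ V : ℝ) + α))) := by
  set s : ℝ := (finrank ℝ V : ℝ) + α
  have hmeas : ∀ ε : ℝ, MeasurableSet {y : V | ε < ‖y‖} := fun ε =>
    measurableSet_lt measurable_const measurable_norm
  have hlim : Tendsto (fun ε : ℝ => ∫ y, {y : V | ε < ‖y‖}.indicator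
      (fun y => secondDiff ψ x y / ‖y‖ ^ s) y) (𝓝[>] 0)
      (𝓝 (∫ y, secondDiff ψ x y / ‖y‖ ^ s)) := by
    have hint := integrable_secondDiff_div_right hα0 hα2 ψ x
    refine tendsto_integral_filter_of_dominated_convergence
      (fun y => ‖secondDiff ψ x y / ‖y‖ ^ s‖) ?_ ?_ hint.norm ?_
    · exact Eventually.of_forall fun ε => hint.aestronglyMeasurable.indicator (hmeas ε)
    · exact Eventually.of_forall fun ε => Eventually.of_forall fun y => norm_indicator_le_norm_self _ _
    · refine Eventually.of_forall fun y => ?_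
      rcases eq_or_ne y 0 with rfl | hy
      · have h0 : secondDiff ψ x 0 = 0 := by simp [secondDiff]; ring
        simp [indicator, h0]
      · refine tendsto_const_nhds.congr' ?_
        filter_upwards [nhdsWithin_le_nhds (eventually_lt_nhds (norm_pos_iff.2 hy))] with ε hε
        rw [indicator_of_mem (by exact hε)]
  refine (hlim.const_mul 2⁻¹).congr' ?_
  filter_upwards [self_mem_nhdsWithin] with ε hε
  have hε : 0 < ε := hε
  set q : V → ℝ := {y : V | ε < ‖y‖}.indicator (fun y => (ψ x - ψ (x - y)) / ‖y‖ ^ s) with hq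
  have hqint : Integrable q := by
    obtain ⟨S, hS0, hS⟩ := schwartz_exists_abs_le ψ
    refine ((integrable_min_one_sq_div_norm_rpow (V := V) hα0 hα2).const_mul
      (2 * S * (min 1 (ε ^ 2))⁻¹)).mono' ?_ (Eventually.of_forall fun y => ?_)
    · have : Continuous fun y => ψ x - ψ (x - y) := by fun_prop
      exact ((this.measurable.div (by fun_prop)).indicator (hmeas ε)).aestronglyMeasurable
    · by_cases hy : ε < ‖y‖
      · rw [hq, indicator_of_mem (by exact hy), norm_div,
          Real.norm_of_nonneg (by positivity : 0 ≤ ‖y‖ ^ s), ← mul_div_assoc]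
        gcongr
        have h1 := abs_le.1 (hS x)
        have h2 := abs_le.1 (hS (x - y))
        have hm : 0 < min 1 (ε ^ 2) := by positivity
        have h3 : min 1 (ε ^ 2) ≤ min 1 (‖y‖ ^ 2) := by gcongr
        calc ‖ψ x - ψ (x - y)‖ ≤ 2 * S := by
              rw [Real.norm_eq_abs, abs_le]
              constructor <;> linarith [h1.1, h1.2, h2.1, h2.2]
          _ = 2 * S * (min 1 (ε ^ 2))⁻¹ * min 1 (ε ^ 2) := by field_simp
          _ ≤ _ := by gcongr
      · rw [hq, indicator_of_notMem (by exact hy), norm_zero]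
        positivity
  have hL : ∫ z in {z : V | ε < ‖x - z‖}, (ψ x - ψ z) / ‖x - z‖ ^ s = ∫ y, q y := by
    rw [← integral_indicator (measurableSet_lt measurable_const (by fun_prop)),
      ← integral_sub_left_eq_self q volume x]
    congr 1 with z
    simp [hq, indicator]
  have hD : ∀ y, {y : V | ε < ‖y‖}.indicator (fun y => secondDiff ψ x y / ‖y‖ ^ s) y
      = q y + q (-y) := by
    intro y
    by_cases hy : ε < ‖y‖
    · simp [hq, indicator, hy, secondDiff]
      ring
    · simp [hq, indicator, hy]
  rw [hL]
  simp_rw [hD]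
  rw [integral_add hqint hqint.comp_neg, integral_neg_eq_self]
  ring

/-- The Fourier transform turns the second difference with step `y` into multiplication by
`2 - 2 cos (2π⟪y, ξ⟫)`. -/
lemma fourier_secondDiff (ψ : SchwartzMap V ℝ) (y ξ : V) :
    𝓕 (fun x => (secondDiff ψ x y : ℂ)) ξ =
      ((2 * (1 - Real.cos (2 * π * inner ℝ y ξ)) : ℝ) : ℂ) * 𝓕 (fun x => (ψ x : ℂ)) ξ := by
  have hψ : Integrable (fun x => (ψ x : ℂ)) := ψ.integrable.ofReal
  have hshift : ∀ v : V, 𝓕 (fun x => (ψ (x + v) : ℂ)) ξ =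
      Complex.exp (((2 * π * inner ℝ v ξ : ℝ) : ℂ) * Complex.I) * 𝓕 (fun x => (ψ x : ℂ)) ξ := by
    intro v
    have := congrFun (VectorFourier.fourierIntegral_comp_add_right Real.fourierChar volume
      (innerₗ V) (fun x => (ψ x : ℂ)) v) ξ
    rw [Circle.smul_def, Real.fourierChar_apply] at this
    exact this
  have hint : ∀ {f : V → ℂ}, Integrable f → Integrable fun v =>
      Real.fourierChar (-inner ℝ v ξ) • f v := fun hf => (Real.fourierIntegral_convergent_iff ξ).2 hf
  have hsplit : 𝓕 (fun x => (secondDiff ψ x y : ℂ)) ξ = 2 * 𝓕 (fun x => (ψ x : ℂ)) ξ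
      - 𝓕 (fun x => (ψ (x + y) : ℂ)) ξ - 𝓕 (fun x => (ψ (x + -y) : ℂ)) ξ := by
    simp only [Real.fourier_eq]
    have h1 := (hint hψ).const_mul 2
    have h2 := hint (hψ.comp_add_right y)
    rw [← integral_const_mul, ← integral_sub h1 h2,
      ← integral_sub (by exact h1.sub h2) (hint (hψ.comp_add_right (-y)))]
    congr 1 with x
    simp only [secondDiff, Circle.smul_def, smul_eq_mul, ← sub_eq_add_neg]
    push_cast
    ring
  rw [hsplit, hshift, hshift, inner_neg_left]
  have hcos := Complex.two_cos (((2 * π * inner ℝ y ξ : ℝ)) : ℂ)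
  push_cast at hcos ⊢
  rw [mul_sub, hcos]
  ring_nf

/-- The Fourier multiplier of the (unnormalised) fractional Laplacian. -/
def fracLapSymbol (α : ℝ) (ξ : V) : ℝ :=
  ∫ y, (1 - Real.cos (2 * π * inner ℝ y ξ)) / ‖y‖ ^ ((finrank ℝ V : ℝ) + α)

lemma fracLapSymbol_linearIsometryEquiv (α : ℝ) (R : V ≃ₗᵢ[ℝ] V) (ξ : V) :
    fracLapSymbol α (R ξ) = fracLapSymbol α ξ := by
  unfold fracLapSymbol
  rw [← R.measurePreserving.integral_comp R.toHomeomorph.measurableEmbedding]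
  simp

lemma fracLapSymbol_smul (α : ℝ) {r : ℝ} (hr : 0 < r) (ξ : V) :
    fracLapSymbol α (r • ξ) = r ^ α * fracLapSymbol α ξ := by
  have h := Measure.integral_comp_smul_of_nonneg (volume : Measure V)
    (fun y => (1 - Real.cos (2 * π * inner ℝ y ξ)) / ‖y‖ ^ ((finrank ℝ V : ℝ) + α)) r (hR := hr.le)
  have hpt : ∀ y : V, (1 - Real.cos (2 * π * inner ℝ y (r • ξ))) / ‖y‖ ^ ((finrank ℝ V : ℝ) + α) =
      r ^ ((finrank ℝ V : ℝ) + α) * ((1 - Real.cos (2 * π * inner ℝ (r • y) ξ)) /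
        ‖r • y‖ ^ ((finrank ℝ V : ℝ) + α)) := by
    intro y
    rw [norm_smul, Real.norm_of_nonneg hr.le, Real.mul_rpow hr.le (norm_nonneg y),
      real_inner_smul_left, real_inner_smul_right]
    have : r ^ ((finrank ℝ V : ℝ) + α) ≠ 0 := (Real.rpow_pos_of_pos hr _).ne'
    rw [← mul_div_assoc, mul_div_mul_left _ _ this]
  unfold fracLapSymbol
  simp_rw [hpt]
  rw [integral_const_mul, h, smul_eq_mul, ← mul_assoc, Real.rpow_add hr, Real.rpow_natCast]
  congr 1
  field_simp

lemma integrable_fracLapSymbol [Nontrivial V] {α : ℝ} (hα0 : 0 < α) (hα2 : α < 2) (ξ : V) :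
    Integrable fun y : V =>
      (1 - Real.cos (2 * π * inner ℝ y ξ)) / ‖y‖ ^ ((finrank ℝ V : ℝ) + α) := by
  refine ((integrable_min_one_sq_div_norm_rpow (V := V) hα0 hα2).const_mul
    (2 + (2 * π * ‖ξ‖) ^ 2)).mono' ?_ (Eventually.of_forall fun y => ?_)
  · have : Continuous fun y : V => 1 - Real.cos (2 * π * inner ℝ y ξ) := by fun_prop
    exact (this.measurable.div (by fun_prop)).aestronglyMeasurable
  · rw [norm_div, Real.norm_of_nonneg (by linarith [Real.cos_le_one (2 * π * inner ℝ y ξ)]),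
      Real.norm_of_nonneg (by positivity), ← mul_div_assoc]
    gcongr
    rcases le_total ‖y‖ 1 with hy | hy
    · rw [min_eq_right (pow_le_one₀ (norm_nonneg y) hy)]
      have h1 := Real.one_sub_sq_div_two_le_cos (x := 2 * π * inner ℝ y ξ)
      have h2 : (inner ℝ y ξ) ^ 2 ≤ (‖y‖ * ‖ξ‖) ^ 2 :=
        sq_le_sq' (neg_le_of_abs_le (abs_real_inner_le_norm y ξ)) (real_inner_le_norm y ξ)
      have h3 : (2 * π) ^ 2 * (inner ℝ y ξ) ^ 2 ≤ (2 * π) ^ 2 * (‖y‖ * ‖ξ‖) ^ 2 := by gcongr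
      have h4 : 0 ≤ (2 * π) ^ 2 * (inner ℝ y ξ) ^ 2 := by positivity
      nlinarith [sq_nonneg ‖y‖]
    · rw [min_eq_left (one_le_pow₀ hy)]
      nlinarith [Real.neg_one_le_cos (2 * π * inner ℝ y ξ), sq_nonneg (2 * π * ‖ξ‖)]

lemma fracLapSymbol_pos [Nontrivial V] {α : ℝ} (hα0 : 0 < α) (hα2 : α < 2) {ξ : V}
    (hξ : ‖ξ‖ = 1) : 0 < fracLapSymbol α ξ := by
  unfold fracLapSymbol
  rw [integral_pos_iff_support_of_nonneg
    (fun y => div_nonneg (by linarith [Real.cos_le_one (2 * π * inner ℝ y ξ)]) (by positivity))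
    (integrable_fracLapSymbol hα0 hα2 ξ)]
  have hU : IsOpen {y : V | 1 - Real.cos (2 * π * inner ℝ y ξ) ≠ 0} :=
    isOpen_ne_fun (by fun_prop) continuous_const
  refine (hU.measure_pos volume ⟨(2⁻¹ : ℝ) • ξ, ?_⟩).trans_le (measure_mono fun y hy => ?_)
  · simp only [mem_ofPred_eq, real_inner_smul_left, real_inner_self_eq_norm_sq, hξ]
    rw [show 2 * π * (2⁻¹ * 1 ^ 2) = π by ring, Real.cos_pi]
    norm_num
  · have hy0 : y ≠ 0 := by
      rintro rfl
      simp at hy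
    exact div_ne_zero hy (Real.rpow_pos_of_pos (norm_pos_iff.2 hy0) _).ne'

lemma fracLapSymbol_eq {α : ℝ} (hα0 : 0 < α) {e : V} (he : ‖e‖ = 1) (ξ : V) :
    fracLapSymbol α ξ = ‖ξ‖ ^ α * fracLapSymbol α e := by
  rcases eq_or_ne ξ 0 with rfl | hξ
  · simp [fracLapSymbol, Real.zero_rpow hα0.ne']
  · have hn : 0 < ‖ξ‖ := norm_pos_iff.2 hξ
    have hunit : ‖e‖ = ‖‖ξ‖⁻¹ • ξ‖ := by
      rw [he, norm_smul, norm_inv, norm_norm, inv_mul_cancel₀ hn.ne']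
    rw [← fracLapSymbol_linearIsometryEquiv α
      (Submodule.reflection (Submodule.span ℝ {e - ‖ξ‖⁻¹ • ξ})ᗮ) e,
      Submodule.reflection_sub hunit, ← fracLapSymbol_smul α hn, smul_inv_smul₀ hn.ne']

/-- Fourier transform of the symmetrised fractional Laplacian. -/
lemma fourier_integral_secondDiff [Nontrivial V] {α : ℝ} (hα0 : 0 < α) (hα2 : α < 2)
    (ψ : SchwartzMap V ℝ) (ξ : V) :
    𝓕 (fun x => ((∫ y, secondDiff ψ x y / ‖y‖ ^ ((finrank ℝ V : ℝ) + α) : ℝ) : ℂ)) ξ =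
      ((2 * fracLapSymbol α ξ : ℝ) : ℂ) * 𝓕 (fun x => (ψ x : ℂ)) ξ := by
  set s : ℝ := (finrank ℝ V : ℝ) + α with hs
  have hprod : Integrable (Function.uncurry fun x y : V =>
      Real.fourierChar (-inner ℝ x ξ) • ((secondDiff ψ x y / ‖y‖ ^ s : ℝ) : ℂ))
      (volume.prod volume) := by
    have h := (integrable_secondDiff_div_prod hα0 hα2 ψ).ofReal (𝕜 := ℂ)
    refine h.norm.mono' ?_ (Eventually.of_forall fun p => le_of_eq (Circle.norm_smul _ _))
    have hc : Continuous fun p : V × V => Real.fourierChar (-inner ℝ p.1 ξ) :=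
      Real.continuous_fourierChar.comp (by fun_prop)
    exact hc.aestronglyMeasurable.smul h.aestronglyMeasurable
  calc 𝓕 (fun x => ((∫ y, secondDiff ψ x y / ‖y‖ ^ s : ℝ) : ℂ)) ξ
      = ∫ x, ∫ y, Real.fourierChar (-inner ℝ x ξ) • ((secondDiff ψ x y / ‖y‖ ^ s : ℝ) : ℂ) := by
        rw [Real.fourier_eq]
        congr 1 with x
        rw [← integral_complex_ofReal]
        simp only [Circle.smul_def]
        rw [integral_smul]
    _ = ∫ y, ∫ x, Real.fourierChar (-inner ℝ x ξ) • ((secondDiff ψ x y / ‖y‖ ^ s : ℝ) : ℂ) :=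
        integral_integral_swap hprod
    _ = ∫ y, (((1 - Real.cos (2 * π * inner ℝ y ξ)) / ‖y‖ ^ s : ℝ) : ℂ) *
          (2 * 𝓕 (fun x => (ψ x : ℂ)) ξ) := by
        congr 1 with y
        have h := fourier_secondDiff ψ y ξ
        rw [Real.fourier_eq] at h
        calc ∫ x, Real.fourierChar (-inner ℝ x ξ) • ((secondDiff ψ x y / ‖y‖ ^ s : ℝ) : ℂ)
            = ∫ x, Real.fourierChar (-inner ℝ x ξ) • (secondDiff ψ x y : ℂ) /
                ((‖y‖ ^ s : ℝ) : ℂ) := by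
              congr 1 with x
              rw [Circle.smul_def, Circle.smul_def, smul_eq_mul, smul_eq_mul, Complex.ofReal_div,
                mul_div_assoc]
          _ = _ := by
              rw [integral_div, h]
              push_cast
              ring
    _ = _ := by
        rw [integral_mul_const, integral_complex_ofReal, fracLapSymbol, ← hs]
        push_cast
        ring

end SecondDifference

/-- There is a normalizing constant `C_{n,α} > 0` such that, for every Schwartz `ψ`,
the principal value defining `(-Δ)^{α/2}ψ` exists everywhere and
`𝓕(C_{n,α} Lψ)(ξ) = |ξ|^α 𝓕(ψ)(ξ)`. -/
theorem fracLap_fourier_symbol (n : ℕ) (hn : 1 ≤ n) (α : ℝ) (hα0 : 0 < α) (hα2 : α < 2) :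
    ∃ C : ℝ, 0 < C ∧
      ∀ ψ : SchwartzMap (EuclideanSpace ℝ (Fin n)) ℝ,
        ∃ Lψ : EuclideanSpace ℝ (Fin n) → ℝ,
          (∀ x, IsFracLapAt n α (fun y => ψ y) x (Lψ x)) ∧
          ∀ ξ : EuclideanSpace ℝ (Fin n),
            𝓕 (fun x : EuclideanSpace ℝ (Fin n) => ((C * Lψ x : ℝ) : ℂ)) ξ =
              ((‖ξ‖ ^ α : ℝ) : ℂ) * 𝓕 (fun x : EuclideanSpace ℝ (Fin n) => ((ψ x : ℝ) : ℂ)) ξ := by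
  have hfin : Module.finrank ℝ (EuclideanSpace ℝ (Fin n)) = n := finrank_euclideanSpace_fin
  have : Nontrivial (EuclideanSpace ℝ (Fin n)) :=
    Module.nontrivial_of_finrank_pos (R := ℝ) (by omega)
  obtain ⟨e, he⟩ := exists_norm_eq (EuclideanSpace ℝ (Fin n)) (zero_le_one' ℝ)
  have hK : 0 < fracLapSymbol α e := fracLapSymbol_pos hα0 hα2 he
  refine ⟨(fracLapSymbol α e)⁻¹, inv_pos.2 hK, fun ψ => ⟨fun x =>
    2⁻¹ * ∫ y, secondDiff ψ x y / ‖y‖ ^ ((n : ℝ) + α), fun x => ?_, fun ξ => ?_⟩⟩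
  · have h := tendsto_principalValue_secondDiff hα0 hα2 ψ x
    rwa [hfin] at h
  · have h := fourier_integral_secondDiff hα0 hα2 ψ ξ
    rw [hfin, fracLapSymbol_eq hα0 he] at h
    rw [Real.fourier_eq] at h ⊢
    have hC : (fracLapSymbol α e : ℂ) ≠ 0 := by exact_mod_cast hK.ne'
    calc _ = ((2 * fracLapSymbol α e : ℝ) : ℂ)⁻¹ *
          ∫ x, Real.fourierChar (-inner ℝ x ξ) •
            ((∫ y, secondDiff ψ x y / ‖y‖ ^ ((n : ℝ) + α) : ℝ) : ℂ) := by
          rw [← integral_const_mul]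
          congr 1 with x
          simp only [Circle.smul_def, smul_eq_mul]
          push_cast
          rw [mul_inv]
          ring
      _ = _ := by
          rw [h]
          push_cast
          field_simp
end
end

section
/- Let n ≥ 1 and 0 < α < 2, and let u ∈ L_α be α-harmonic in the sense of distributions. Then for every φ ∈ C_c^∞(ℝⁿ) whose support does not contain the origin, ∫_{ℝⁿ} u(x) F(φ)(x) dx = 0; that is, the Fourier transform of u (as a tempered distribution) vanishes on ℝⁿ \ {0}. -/
open MeasureTheory Filter Topology Metric FourierTransform

noncomputable section

/-- Membership in the space `L_α`. -/
def InLalpha (n : ℕ) (α : ℝ) (u : EuclideanSpace ℝ (Fin n) → ℝ) : Prop :=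
  Integrable (fun x : EuclideanSpace ℝ (Fin n) => u x / (1 + ‖x‖ ^ ((n : ℝ) + α)))

/-- `α`-harmonicity in the sense of distributions. -/
def AlphaHarmonic (n : ℕ) (α : ℝ) (u : EuclideanSpace ℝ (Fin n) → ℝ) : Prop :=
  ∀ φ : EuclideanSpace ℝ (Fin n) → ℝ, ContDiff ℝ (⊤ : ℕ∞) φ → HasCompactSupport φ →
    ∀ g : EuclideanSpace ℝ (Fin n) → ℝ,
      (∀ x, IsFracLapAt n α φ x (g x)) → ∫ x, u x * g x = 0

namespace FractionalLaplacian

open Module Set Function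
open scoped RealInnerProductSpace ContDiff

/-- The second difference `2 f(x) - f(x + y) - f(x - y)`. -/
def secondDiff {V F : Type*} [AddCommGroup V] [AddCommGroup F] (f : V → F) (x y : V) : F :=
  (f x - f (x + y)) + (f x - f (x - y))

section Kernel

variable {V : Type*} [NormedAddCommGroup V]

/-- The kernel `min(1, |y|²) / |y|^s`, which dominates all second differences below. -/
def truncKernel (s : ℝ) (y : V) : ℝ := min 1 (‖y‖ ^ 2) * (‖y‖ ^ s)⁻¹

lemma truncKernel_nonneg (s : ℝ) (y : V) : 0 ≤ truncKernel s y := by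
  unfold truncKernel; positivity

lemma integrable_truncKernel [InnerProductSpace ℝ V] [FiniteDimensional ℝ V] [MeasurableSpace V] [BorelSpace V]
    [Nontrivial V] {s : ℝ} (h1 : (finrank ℝ V : ℝ) < s) (h2 : s < finrank ℝ V + 2) :
    Integrable (truncKernel s : V → ℝ) := by
  have hd : 0 < finrank ℝ V := finrank_pos
  refine (integrable_fun_norm_addHaar (E := V) volume
    (f := fun r => min 1 (r ^ 2) * (r ^ s)⁻¹)).2 ?_
  have hmeas : Measurable fun r : ℝ => r ^ (finrank ℝ V - 1) • (min 1 (r ^ 2) * (r ^ s)⁻¹) := by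
    fun_prop
  have key : ∀ r : ℝ, 0 < r → r ^ (finrank ℝ V - 1) • (min 1 (r ^ 2) * (r ^ s)⁻¹)
      = min 1 (r ^ 2) * r ^ ((finrank ℝ V : ℝ) - 1 - s) := by
    intro r hr
    rw [Real.rpow_sub hr, ← Nat.cast_pred hd, Real.rpow_natCast, smul_eq_mul]
    ring
  rw [← Ioc_union_Ioi_eq_Ioi (zero_le_one' ℝ)]
  refine IntegrableOn.union ?_ ?_
  · have h : IntegrableOn (fun r : ℝ => r ^ ((finrank ℝ V : ℝ) + 1 - s)) (Ioc 0 1) := by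
      rw [← intervalIntegrable_iff_integrableOn_Ioc_of_le zero_le_one]
      exact intervalIntegral.intervalIntegrable_rpow' (by linarith)
    refine Integrable.mono' h hmeas.aestronglyMeasurable ?_
    refine (ae_restrict_iff' measurableSet_Ioc).2 (Eventually.of_forall fun r hr => ?_)
    rw [key r hr.1, show (finrank ℝ V : ℝ) + 1 - s = 2 + (finrank ℝ V - 1 - s) by ring,
      Real.rpow_add hr.1, Real.norm_of_nonneg (by have := hr.1; positivity)]
    have := hr.1
    gcongr
    exact_mod_cast min_le_right _ _
  · have h : IntegrableOn (fun r : ℝ => r ^ ((finrank ℝ V : ℝ) - 1 - s)) (Ioi 1) :=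
      integrableOn_Ioi_rpow_of_lt (by linarith) one_pos
    refine Integrable.mono' h hmeas.aestronglyMeasurable ?_
    refine (ae_restrict_iff' measurableSet_Ioi).2 (Eventually.of_forall fun r hr => ?_)
    have hr0 : 0 < r := one_pos.trans hr
    rw [key r hr0, Real.norm_of_nonneg (by positivity)]
    exact mul_le_of_le_one_left (by positivity) (min_le_left _ _)

/-- The weight `(1 + |x|)^(-s)`. -/
def weight (s : ℝ) (x : V) : ℝ := (1 + ‖x‖) ^ (-s)

lemma weight_pos (s : ℝ) (x : V) : 0 < weight s x := by
  unfold weight; positivity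

lemma weight_le {s : ℝ} (hs : 0 ≤ s) (x : V) {t : ℝ} (ht : (1 + ‖x‖) / 2 ≤ t) :
    t ^ (-s) ≤ 2 ^ s * weight s x := by
  have h0 : 0 < (1 + ‖x‖) / 2 := by positivity
  calc t ^ (-s) ≤ ((1 + ‖x‖) / 2) ^ (-s) :=
        Real.rpow_le_rpow_of_nonpos h0 ht (by linarith)
    _ = 2 ^ s * weight s x := by
        rw [weight, Real.div_rpow (by positivity) (by norm_num), Real.rpow_neg zero_le_two,
          div_inv_eq_mul, mul_comm]

/-- The dominating function for the second differences of functions decaying like the weight. -/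
def majorant (s : ℝ) (x y : V) : ℝ :=
  8 * 2 ^ s * truncKernel s y + 2 ^ s * (weight s (x + y) + weight s (x - y))

end Kernel

section Bounds

variable {V : Type*} [NormedAddCommGroup V] [NormedSpace ℝ V]
  {F : Type*} [NormedAddCommGroup F] [NormedSpace ℝ F]

lemma norm_secondDiff_le_sq {f : V → F} (hf : ContDiff ℝ 2 f) {x y : V} {M : ℝ}
    (hM : ∀ z ∈ closedBall x ‖y‖, ‖fderiv ℝ (fderiv ℝ f) z‖ ≤ M) :
    ‖secondDiff f x y‖ ≤ M * ‖y‖ ^ 2 := by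
  have hd : Differentiable ℝ f := hf.differentiable (by norm_num)
  have hd' : Differentiable ℝ (fderiv ℝ f) :=
    (hf.fderiv_right (m := 1) (by norm_num)).differentiable (by norm_num)
  have hseg : ∀ z ∈ segment ℝ (x - y) x, z ∈ closedBall x ‖y‖ ∧ z + y ∈ closedBall x ‖y‖ := by
    intro z hz
    have h1 : segment ℝ (x - y) x ⊆ closedBall x ‖y‖ :=
      (convex_closedBall x ‖y‖).segment_subset (by simp) (by simp)
    have h2 : segment ℝ (x - y) x ⊆ closedBall (x - y) ‖y‖ :=
      (convex_closedBall (x - y) ‖y‖).segment_subset (by simp) (by simp)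
    refine ⟨h1 hz, ?_⟩
    have := h2 hz
    rw [mem_closedBall, dist_eq_norm] at this ⊢
    convert this using 2
    abel
  have hderiv : ∀ z, HasFDerivAt (fun z => f (z + y) - f z)
      (fderiv ℝ f (z + y) - fderiv ℝ f z) z := fun z =>
    ((hasFDerivAt_comp_add_right y).2 (hd (z + y)).hasFDerivAt).sub (hd z).hasFDerivAt
  have hbound : ∀ z ∈ segment ℝ (x - y) x,
      ‖fderiv ℝ (fun z => f (z + y) - f z) z‖ ≤ M * ‖y‖ := by
    intro z hz
    rw [(hderiv z).fderiv]
    have := (convex_closedBall x ‖y‖).norm_image_sub_le_of_norm_fderiv_le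
      (fun w _ => hd' w) hM (hseg z hz).1 (hseg z hz).2
    simpa using this
  have := (convex_segment (x - y) x).norm_image_sub_le_of_norm_fderiv_le
    (fun w _ => (hderiv w).differentiableAt) hbound
    (right_mem_segment ℝ (x - y) x) (left_mem_segment ℝ (x - y) x)
  have e : secondDiff f x y = (f (x - y + y) - f (x - y)) - (f (x + y) - f x) := by
    simp only [secondDiff, sub_add_cancel]; abel
  rw [e]
  refine this.trans (le_of_eq ?_)
  rw [sub_sub_cancel_left, norm_neg]; ring

/-- `f` is `C²`, and `f` and its second derivative are bounded by `C (1 + |x|)^(-s)`. -/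
structure DecaysWith (s C : ℝ) (f : V → F) : Prop where
  contDiff : ContDiff ℝ 2 f
  norm_le : ∀ x, ‖f x‖ ≤ C * weight s x
  norm_fderiv_le : ∀ x, ‖fderiv ℝ (fderiv ℝ f) x‖ ≤ C * weight s x

lemma DecaysWith.nonneg {s C : ℝ} {f : V → F} (hf : DecaysWith s C f) : 0 ≤ C :=
  nonneg_of_mul_nonneg_left ((norm_nonneg _).trans (hf.norm_le 0)) (weight_pos s (0 : V))

lemma DecaysWith.norm_secondDiff_le {s C : ℝ} (hs : 0 ≤ s) {f : V → F} (hf : DecaysWith s C f)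
    (x y : V) :
    (‖y‖ ^ s)⁻¹ * ‖secondDiff f x y‖ ≤ C * weight s x * majorant s x y := by
  have hC := hf.nonneg
  have hw := (weight_pos s x).le
  have hwp := (weight_pos s (x + y)).le
  have hwm := (weight_pos s (x - y)).le
  have h2 : (1 : ℝ) ≤ 2 ^ s := Real.one_le_rpow (by norm_num) hs
  have hk : 0 ≤ (‖y‖ ^ s)⁻¹ := by positivity
  have htriv : ‖secondDiff f x y‖ ≤
      C * (2 * weight s x + weight s (x + y) + weight s (x - y)) := by
    have h := norm_add_le (f x - f (x + y)) (f x - f (x - y))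
    have ha := norm_sub_le (f x) (f (x + y))
    have hb := norm_sub_le (f x) (f (x - y))
    have := hf.norm_le x
    have := hf.norm_le (x + y)
    have := hf.norm_le (x - y)
    unfold secondDiff
    linarith
  by_cases hy : ‖y‖ ≤ (1 + ‖x‖) / 2
  · have hball : ∀ z ∈ closedBall x ‖y‖, weight s z ≤ 2 ^ s * weight s x := by
      intro z hz
      refine weight_le hs x ?_
      rw [mem_closedBall, dist_comm, dist_eq_norm] at hz
      have := norm_sub_norm_le x z
      linarith
    have h1 : ‖secondDiff f x y‖ ≤ C * (2 ^ s * weight s x) * ‖y‖ ^ 2 :=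
      norm_secondDiff_le_sq hf.contDiff fun z hz =>
        (hf.norm_fderiv_le z).trans (by gcongr; exact hball z hz)
    have h3 : ‖secondDiff f x y‖ ≤ C * (4 * 2 ^ s * weight s x) := by
      refine htriv.trans ?_
      have ha := hball (x + y) (by simp)
      have hb := hball (x - y) (by simp)
      gcongr
      nlinarith
    have h4 : ‖secondDiff f x y‖ ≤ C * (4 * 2 ^ s * weight s x) * min 1 (‖y‖ ^ 2) := by
      rcases min_choice 1 (‖y‖ ^ 2) with h | h <;> rw [h]
      · simpa using h3
      · refine h1.trans ?_
        gcongr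
        nlinarith
    calc (‖y‖ ^ s)⁻¹ * ‖secondDiff f x y‖
        ≤ (‖y‖ ^ s)⁻¹ * (C * (4 * 2 ^ s * weight s x) * min 1 (‖y‖ ^ 2)) := by gcongr
      _ = C * weight s x * (4 * 2 ^ s * truncKernel s y) := by unfold truncKernel; ring
      _ ≤ C * weight s x * majorant s x y := by
          have := truncKernel_nonneg s y
          unfold majorant
          gcongr
          have : 0 ≤ 2 ^ s * (weight s (x + y) + weight s (x - y)) := by positivity
          nlinarith [mul_nonneg (zero_le_one.trans h2) (truncKernel_nonneg s y)]
  · rw [not_le] at hy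
    have hmin : (1 : ℝ) / 4 ≤ min 1 (‖y‖ ^ 2) := by
      have : 1 / 2 ≤ ‖y‖ := by linarith [norm_nonneg x]
      exact le_min (by norm_num) (by nlinarith)
    have hkw : (‖y‖ ^ s)⁻¹ ≤ 2 ^ s * weight s x := by
      rw [← Real.rpow_neg (norm_nonneg y)]; exact weight_le hs x hy.le
    calc (‖y‖ ^ s)⁻¹ * ‖secondDiff f x y‖
        ≤ (‖y‖ ^ s)⁻¹ * (C * (2 * weight s x + weight s (x + y) + weight s (x - y))) := by
          gcongr
      _ = C * weight s x * (8 * (1 / 4 * (‖y‖ ^ s)⁻¹))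
          + C * ((‖y‖ ^ s)⁻¹ * (weight s (x + y) + weight s (x - y))) := by ring
      _ ≤ C * weight s x * (8 * 2 ^ s * truncKernel s y)
          + C * (2 ^ s * weight s x * (weight s (x + y) + weight s (x - y))) := by
          have h5 : 1 / 4 * (‖y‖ ^ s)⁻¹ ≤ 2 ^ s * truncKernel s y :=
            (mul_le_mul_of_nonneg_right hmin hk).trans
              (le_mul_of_one_le_left (truncKernel_nonneg s y) h2)
          gcongr ?_ + ?_
          · rw [mul_assoc 8]; gcongr
          · gcongr
      _ = C * weight s x * majorant s x y := by unfold majorant; ring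

end Bounds

lemma continuous_secondDiff {V F : Type*} [NormedAddCommGroup V] [NormedAddCommGroup F] {f : V → F} (hf : Continuous f) :
    Continuous fun p : V × V => secondDiff f p.1 p.2 := by
  unfold secondDiff; fun_prop

lemma norm_smul_secondDiff {V F : Type*} [NormedAddCommGroup V] [NormedAddCommGroup F]
    [NormedSpace ℝ F] (s : ℝ) (f : V → F) (x y : V) :
    ‖(‖y‖ ^ s)⁻¹ • secondDiff f x y‖ = (‖y‖ ^ s)⁻¹ * ‖secondDiff f x y‖ := by
  rw [norm_smul, Real.norm_of_nonneg (by positivity)]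

section SymFracLap

variable {V : Type*} [NormedAddCommGroup V] [NormedSpace ℝ V] [MeasureSpace V]
  {F G : Type*} [NormedAddCommGroup F] [NormedSpace ℝ F] [NormedAddCommGroup G] [NormedSpace ℝ G]

/-- Twice the (unnormalized) fractional Laplacian, in second-difference form. -/
def symFracLap (s : ℝ) (f : V → F) (x : V) : F :=
  ∫ y, (‖y‖ ^ s)⁻¹ • secondDiff f x y

end SymFracLap

section Estimates

variable {V : Type*} [NormedAddCommGroup V] [InnerProductSpace ℝ V] [FiniteDimensional ℝ V]
  [MeasurableSpace V] [BorelSpace V]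
  {F G : Type*} [NormedAddCommGroup F] [NormedSpace ℝ F] [NormedAddCommGroup G] [NormedSpace ℝ G]
  {s C : ℝ}

lemma integrable_majorant [Nontrivial V] (h1 : (finrank ℝ V : ℝ) < s) (h2 : s < finrank ℝ V + 2) (x : V) :
    Integrable (majorant s x) := by
  have hw : Integrable (weight s : V → ℝ) := integrable_one_add_norm h1
  exact ((integrable_truncKernel h1 h2).const_mul _).add
    (((hw.comp_add_left x).add (hw.comp_sub_left x)).const_mul _)

lemma integral_majorant [Nontrivial V] (h1 : (finrank ℝ V : ℝ) < s) (h2 : s < finrank ℝ V + 2) (x : V) :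
    ∫ y, majorant s x y =
      8 * 2 ^ s * (∫ y : V, truncKernel s y) + 2 ^ s * (2 * ∫ y : V, weight s y) := by
  have hw : Integrable (weight s : V → ℝ) := integrable_one_add_norm h1
  have hpm : Integrable fun y => weight s (x + y) + weight s (x - y) :=
    (hw.comp_add_left x).add (hw.comp_sub_left x)
  unfold majorant
  rw [integral_add ((integrable_truncKernel h1 h2).const_mul _) (hpm.const_mul _),
    integral_const_mul,
    integral_const_mul, integral_add (hw.comp_add_left x) (hw.comp_sub_left x),
    integral_add_left_eq_self (weight s), integral_sub_left_eq_self (weight s)]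
  ring

lemma aestronglyMeasurable_smul_secondDiff {f : V → F} (hf : Continuous f) (x : V) :
    AEStronglyMeasurable fun y => (‖y‖ ^ s)⁻¹ • secondDiff f x y := by
  have hm : Measurable fun y : V => (‖y‖ ^ s)⁻¹ := by fun_prop
  have hc : Continuous fun y => secondDiff f x y :=
    (continuous_secondDiff hf).comp (Continuous.prodMk_right x)
  exact hm.aestronglyMeasurable.smul hc.aestronglyMeasurable

lemma DecaysWith.integrable_smul_secondDiff [Nontrivial V] (h1 : (finrank ℝ V : ℝ) < s)
    (h2 : s < finrank ℝ V + 2) {f : V → F} (hf : DecaysWith s C f) (x : V) :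
    Integrable fun y => (‖y‖ ^ s)⁻¹ • secondDiff f x y :=
  ((integrable_majorant h1 h2 x).const_mul (C * weight s x)).mono'
    (aestronglyMeasurable_smul_secondDiff hf.contDiff.continuous x) <|
    Eventually.of_forall fun y => by
      rw [norm_smul_secondDiff]
      exact hf.norm_secondDiff_le ((Nat.cast_nonneg _).trans h1.le) x y

lemma DecaysWith.norm_symFracLap_le [Nontrivial V] (h1 : (finrank ℝ V : ℝ) < s)
    (h2 : s < finrank ℝ V + 2) {f : V → F} (hf : DecaysWith s C f) (x : V) :
    ‖symFracLap s f x‖ ≤ C * (8 * 2 ^ s * (∫ y : V, truncKernel s y)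
      + 2 ^ s * (2 * ∫ y : V, weight s y)) * weight s x := by
  rw [mul_right_comm, ← integral_majorant h1 h2 x, ← integral_const_mul]
  refine norm_integral_le_of_norm_le ((integrable_majorant h1 h2 x).const_mul _) <|
    Eventually.of_forall fun y => ?_
  rw [norm_smul_secondDiff]
  exact hf.norm_secondDiff_le ((Nat.cast_nonneg _).trans h1.le) x y

lemma tendsto_symFracLap [Nontrivial V] (h1 : (finrank ℝ V : ℝ) < s) (h2 : s < finrank ℝ V + 2)
    {f : ℕ → V → F} {g : V → F} (hf : ∀ k, DecaysWith s C (f k))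
    (hlim : ∀ x, Tendsto (fun k => f k x) atTop (𝓝 (g x))) (x : V) :
    Tendsto (fun k => symFracLap s (f k) x) atTop (𝓝 (symFracLap s g x)) := by
  refine tendsto_integral_of_dominated_convergence _
    (fun k => aestronglyMeasurable_smul_secondDiff (hf k).contDiff.continuous x)
    ((integrable_majorant h1 h2 x).const_mul (C * weight s x))
    (fun k => Eventually.of_forall fun y => ?_) (Eventually.of_forall fun y => ?_)
  · rw [norm_smul_secondDiff]
    exact (hf k).norm_secondDiff_le ((Nat.cast_nonneg _).trans h1.le) x y
  · exact (((hlim x).sub (hlim _)).add ((hlim x).sub (hlim _))).const_smul _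

lemma stronglyMeasurable_symFracLap {f : V → F} (hf : Continuous f) :
    StronglyMeasurable (symFracLap s f) := by
  have hm : Measurable fun p : V × V => (‖p.2‖ ^ s)⁻¹ := by fun_prop
  exact (hm.stronglyMeasurable.smul
    (continuous_secondDiff hf).stronglyMeasurable).integral_prod_right

lemma symFracLap_clm_comp (L : F →L[ℝ] G) {f : V → F} {x : V} [CompleteSpace F] [CompleteSpace G]
    (hi : Integrable fun y => (‖y‖ ^ s)⁻¹ • secondDiff f x y) :
    symFracLap s (fun x => L (f x)) x = L (symFracLap s f x) := by
  unfold symFracLap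
  rw [← L.integral_comp_comm hi]
  simp [secondDiff]

/-- Truncated symmetric integrals converge to the second-difference form. -/
lemma DecaysWith.tendsto_principalValue [Nontrivial V] (h1 : (finrank ℝ V : ℝ) < s)
    (h2 : s < finrank ℝ V + 2) {f : V → ℝ} (hf : DecaysWith s C f) (x : V) :
    Tendsto (fun ε : ℝ => ∫ z in {z : V | ε < ‖x - z‖}, (f x - f z) / ‖x - z‖ ^ s)
      (𝓝[>] 0) (𝓝 (2⁻¹ * symFracLap s f x)) := by
  have hcont := hf.contDiff.continuous
  have hmeas : ∀ ε : ℝ, MeasurableSet {y : V | ε < ‖y‖} := fun ε =>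
    measurableSet_lt measurable_const measurable_norm
  have hs : 0 ≤ s := (Nat.cast_nonneg _).trans h1.le
  have hbdd : ∀ w, |f w| ≤ C := fun w => (hf.norm_le w).trans <|
    mul_le_of_le_one_right hf.nonneg <|
      Real.rpow_le_one_of_one_le_of_nonpos (by linarith [norm_nonneg w]) (by linarith)
  have hint : ∀ ε : ℝ, 0 < ε → ∀ g : V → V, Continuous g →
      IntegrableOn (fun y => (‖y‖ ^ s)⁻¹ * (f x - f (g y))) {y : V | ε < ‖y‖} := by
    intro ε hε g hg
    have hm : Measurable fun y : V => (‖y‖ ^ s)⁻¹ * (f x - f (g y)) := by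
      have : Measurable fun y : V => f (g y) := (hcont.comp hg).measurable
      fun_prop
    refine Integrable.mono' (((integrable_truncKernel h1 h2).const_mul
      (2 * C * (min 1 (ε ^ 2))⁻¹)).integrableOn) hm.aestronglyMeasurable ?_
    refine (ae_restrict_iff' (hmeas ε)).2 (Eventually.of_forall fun y hy => ?_)
    have hy' : ε < ‖y‖ := hy
    have hme : 0 < min 1 (ε ^ 2) := by positivity
    have hle : min 1 (ε ^ 2) ≤ min 1 (‖y‖ ^ 2) := by gcongr
    have hd : |f x - f (g y)| ≤ 2 * C := by
      have := abs_sub (f x) (f (g y))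
      linarith [hbdd x, hbdd (g y)]
    rw [norm_mul, Real.norm_of_nonneg (by positivity : 0 ≤ (‖y‖ ^ s)⁻¹), Real.norm_eq_abs]
    have hCn := hf.nonneg
    calc (‖y‖ ^ s)⁻¹ * |f x - f (g y)| ≤ (‖y‖ ^ s)⁻¹ * (2 * C) := by gcongr
      _ = 2 * C * (min 1 (ε ^ 2))⁻¹ * (min 1 (ε ^ 2) * (‖y‖ ^ s)⁻¹) := by
          field_simp
      _ ≤ _ := by unfold truncKernel; gcongr
  have hplus : ∀ ε : ℝ, ∫ z in {z : V | ε < ‖x - z‖}, (f x - f z) / ‖x - z‖ ^ s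
      = ∫ y in {y : V | ε < ‖y‖}, (‖y‖ ^ s)⁻¹ * (f x - f (x + y)) := by
    intro ε
    rw [← integral_indicator (hmeas ε), ← integral_indicator
      (measurableSet_lt measurable_const (by fun_prop)), ← integral_add_left_eq_self _ x]
    congr 1 with y
    simp [indicator, div_eq_inv_mul]
  have hminus : ∀ ε : ℝ, ∫ z in {z : V | ε < ‖x - z‖}, (f x - f z) / ‖x - z‖ ^ s
      = ∫ y in {y : V | ε < ‖y‖}, (‖y‖ ^ s)⁻¹ * (f x - f (x - y)) := by
    intro ε
    rw [← integral_indicator (hmeas ε), ← integral_indicator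
      (measurableSet_lt measurable_const (by fun_prop)), ← integral_sub_left_eq_self _ _ x]
    congr 1 with y
    simp [indicator, div_eq_inv_mul]
  have hsym : ∀ ε : ℝ, 0 < ε →
      ∫ z in {z : V | ε < ‖x - z‖}, (f x - f z) / ‖x - z‖ ^ s
      = 2⁻¹ * ∫ y, {y : V | ε < ‖y‖}.indicator (fun y => (‖y‖ ^ s)⁻¹ • secondDiff f x y) y := by
    intro ε hε
    have h := integral_add (hint ε hε (fun y => x + y) (by fun_prop))
      (hint ε hε (fun y => x - y) (by fun_prop))
    rw [← hplus, ← hminus] at h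
    rw [integral_indicator (hmeas ε)]
    simp only [secondDiff, smul_eq_mul, mul_add]
    rw [h]; ring
  refine Tendsto.congr' (f₁ := fun ε => 2⁻¹ * ∫ y, {y : V | ε < ‖y‖}.indicator
    (fun y => (‖y‖ ^ s)⁻¹ • secondDiff f x y) y)
    (eventually_mem_nhdsWithin.mono fun ε hε => (hsym ε hε).symm) ?_
  refine Tendsto.const_mul _ ?_
  refine tendsto_integral_filter_of_dominated_convergence
    (fun y => ‖(‖y‖ ^ s)⁻¹ • secondDiff f x y‖)
    (Eventually.of_forall fun ε =>
      (aestronglyMeasurable_smul_secondDiff hcont x).indicator (hmeas ε))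
    (Eventually.of_forall fun ε => Eventually.of_forall fun y => norm_indicator_le_norm_self _ _)
    (hf.integrable_smul_secondDiff h1 h2 x).norm (Eventually.of_forall fun y => ?_)
  rcases eq_or_ne y 0 with rfl | hy
  · have : ∀ ε : ℝ, {y : V | ε < ‖y‖}.indicator
        (fun y => (‖y‖ ^ s)⁻¹ • secondDiff f x y) 0 = (‖(0 : V)‖ ^ s)⁻¹ • secondDiff f x 0 := by
      intro ε; simp [indicator, secondDiff]
    simp_rw [this]
    exact tendsto_const_nhds
  · refine tendsto_const_nhds.congr' ?_
    filter_upwards [nhdsWithin_le_nhds (Iio_mem_nhds (norm_pos_iff.2 hy))] with ε hε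
    rw [indicator_of_mem]
    exact hε

end Estimates

section Cutoff

open SchwartzMap

variable {V : Type*} [NormedAddCommGroup V]
  {F : Type*} [NormedAddCommGroup F] [NormedSpace ℝ F]

lemma norm_fderiv_fderiv [NormedSpace ℝ V] (f : V → F) (x : V) :
    ‖fderiv ℝ (fderiv ℝ f) x‖ = ‖iteratedFDeriv ℝ 2 f x‖ := by
  rw [← norm_iteratedFDeriv_one, norm_iteratedFDeriv_fderiv]

lemma exists_norm_iteratedFDeriv_le_weight [NormedSpace ℝ V] (s : ℝ) (f : 𝓢(V, F)) :
    ∃ C, ∀ i ≤ 2, ∀ x, ‖iteratedFDeriv ℝ i f x‖ ≤ C * weight s x := by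
  obtain ⟨k, hk⟩ := exists_nat_ge s
  refine ⟨2 ^ k * (Finset.Iic (k, 2)).sup (fun m => SchwartzMap.seminorm ℝ m.1 m.2) f,
    fun i hi x => ?_⟩
  have h := one_add_le_sup_seminorm_apply (𝕜 := ℝ) (m := (k, 2)) le_rfl hi f x
  have hp : (1 + ‖x‖) ^ s ≤ (1 + ‖x‖) ^ k := by
    rw [← Real.rpow_natCast]
    exact Real.rpow_le_rpow_of_exponent_le (by linarith [norm_nonneg x]) hk
  rw [weight, Real.rpow_neg (by positivity), ← div_eq_mul_inv, le_div_iff₀ (by positivity),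
    mul_comm]
  exact (mul_le_mul_of_nonneg_right hp (norm_nonneg _)).trans h

lemma exists_decaysWith [NormedSpace ℝ V] (s : ℝ) (f : 𝓢(V, F)) : ∃ C, DecaysWith s C f := by
  obtain ⟨C, hC⟩ := exists_norm_iteratedFDeriv_le_weight s f
  refine ⟨C, f.smooth 2, fun x => ?_, fun x => ?_⟩
  · simpa using hC 0 (by norm_num) x
  · rw [norm_fderiv_fderiv]; exact hC 2 le_rfl x

/-- A Schwartz function is a pointwise limit of smooth compactly supported functions which decay
uniformly together with their second derivatives. -/
lemma exists_cutoff_approximation [InnerProductSpace ℝ V] [FiniteDimensional ℝ V]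
    (s : ℝ) (f : 𝓢(V, F)) :
    ∃ (C : ℝ) (g : ℕ → V → F), (∀ k, ContDiff ℝ ∞ (g k)) ∧ (∀ k, HasCompactSupport (g k)) ∧
      (∀ k, DecaysWith s C (g k)) ∧ ∀ x, Tendsto (fun k => g k x) atTop (𝓝 (f x)) := by
  obtain ⟨C, hC⟩ := exists_norm_iteratedFDeriv_le_weight s f
  have hC0 : 0 ≤ C := nonneg_of_mul_nonneg_left
    ((norm_nonneg _).trans (hC 0 (by norm_num) 0)) (weight_pos s (0 : V))
  let χ : ContDiffBump (0 : V) := ⟨1, 2, one_pos, one_lt_two⟩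
  have hχ : ContDiff ℝ ∞ χ := χ.contDiff
  have hχb : ∀ i, ∃ M, ∀ x, ‖iteratedFDeriv ℝ i χ x‖ ≤ M := fun i =>
    (hχ.continuous_iteratedFDeriv (by exact_mod_cast le_top)).bounded_above_of_compact_support
      (χ.hasCompactSupport.iteratedFDeriv i)
  choose M hM using hχb
  let c : ℕ → ℝ := fun k => ((k : ℝ) + 1)⁻¹
  have hc0 : ∀ k, 0 < c k := fun k => by positivity
  have hc1 : ∀ k, c k ≤ 1 := fun k => inv_le_one_of_one_le₀ (by simp)
  have hclim : Tendsto c atTop (𝓝 0) := by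
    simpa [c] using tendsto_one_div_add_atTop_nhds_zero_nat (𝕜 := ℝ)
  let L : ℕ → V →L[ℝ] V := fun k => c k • ContinuousLinearMap.id ℝ V
  have hL : ∀ k, ‖L k‖ ≤ 1 := fun k => by
    rw [norm_smul, Real.norm_of_nonneg (hc0 k).le]
    exact mul_le_one₀ (hc1 k) (norm_nonneg _) ContinuousLinearMap.norm_id_le
  let χc : ℕ → V → ℝ := fun k => χ ∘ L k
  have hχc : ∀ k, ContDiff ℝ ∞ (χc k) := fun k => hχ.comp (L k).contDiff
  have hχcb : ∀ k i x, ‖iteratedFDeriv ℝ i (χc k) x‖ ≤ M i := by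
    intro k i x
    rw [ContinuousLinearMap.iteratedFDeriv_comp_right (L k) hχ x (i := i)
      (by exact_mod_cast le_top)]
    refine (ContinuousMultilinearMap.norm_compContinuousLinearMap_le _ _).trans ?_
    rw [Finset.prod_const]
    exact (mul_le_of_le_one_right (norm_nonneg _) (pow_le_one₀ (norm_nonneg _) (hL k))).trans
      (hM i _)
  have hM0 : ∀ i, 0 ≤ M i := fun i => (norm_nonneg _).trans (hM i 0)
  have hf := f.smooth ⊤
  have hbound : ∀ k, ∀ j ≤ 2, ∀ x, ‖iteratedFDeriv ℝ j (fun x => χc k x • f x) x‖ ≤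
      (∑ i ∈ Finset.range (j + 1), (j.choose i : ℝ) * M i * C) * weight s x := by
    intro k j hj x
    refine (norm_iteratedFDeriv_smul_le (hχc k) hf x (n := j) (by exact_mod_cast le_top)).trans ?_
    rw [Finset.sum_mul]
    refine Finset.sum_le_sum fun i _ => ?_
    rw [mul_assoc _ C]
    gcongr
    · exact mul_nonneg (Nat.cast_nonneg _) (hM0 i)
    · exact hχcb k i x
    · exact hC _ ((Nat.sub_le _ _).trans hj) x
  let D : ℕ → ℝ := fun j => ∑ i ∈ Finset.range (j + 1), (j.choose i : ℝ) * M i * C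
  have hgs : ∀ k, ContDiff ℝ ∞ fun x => χc k x • f x := fun k => (hχc k).smul hf
  refine ⟨max (D 0) (D 2), fun k x => χc k x • f x, hgs, fun k => ?_, fun k => ⟨?_, ?_, ?_⟩,
    fun x => ?_⟩
  · refine HasCompactSupport.smul_right ?_
    exact χ.hasCompactSupport.comp_homeomorph (Homeomorph.smulOfNeZero (c k) (hc0 k).ne')
  · exact contDiff_infty.1 (hgs k) 2
  · intro x
    have := hbound k 0 (by norm_num) x
    rw [norm_iteratedFDeriv_zero] at this
    refine this.trans ?_
    have := weight_pos s x
    gcongr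
    exact le_max_left _ _
  · intro x
    rw [norm_fderiv_fderiv]
    refine (hbound k 2 le_rfl x).trans ?_
    have := weight_pos s x
    gcongr
    exact le_max_right _ _
  · have h1 : Tendsto (fun k => χ (c k • x)) atTop (𝓝 (χ ((0 : ℝ) • x))) :=
      (hχ.continuous.tendsto _).comp (hclim.smul_const x)
    have h2 : χ ((0 : ℝ) • x) = 1 := by
      rw [zero_smul]; exact χ.one_of_mem_closedBall (by simp [χ])
    rw [h2] at h1
    simpa [χc, L] using h1.smul_const (f x)

end Cutoff

section Pairing

open SchwartzMap

variable {n : ℕ} {α : ℝ} {u : EuclideanSpace ℝ (Fin n) → ℝ}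

lemma one_add_rpow_le_weight_inv {V : Type*} [NormedAddCommGroup V] {s : ℝ} (hs : 0 ≤ s) (x : V) :
    (1 + ‖x‖ ^ s) * weight s x ≤ 2 := by
  have h1 : (1 : ℝ) ≤ (1 + ‖x‖) ^ s :=
    Real.one_le_rpow (by linarith [norm_nonneg x]) hs
  have h2 : ‖x‖ ^ s ≤ (1 + ‖x‖) ^ s := by gcongr; linarith
  rw [weight, Real.rpow_neg (by positivity), ← div_eq_mul_inv, div_le_iff₀ (by positivity)]
  linarith

lemma integrable_mul_weight (hα : 0 < α) (hu : InLalpha n α u) :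
    Integrable fun x => ‖u x‖ * weight (n + α) x := by
  have hs : 0 ≤ (n : ℝ) + α := by positivity
  have hm : Measurable fun x : EuclideanSpace ℝ (Fin n) =>
      (1 + ‖x‖ ^ ((n : ℝ) + α)) * weight (n + α) x := by
    unfold weight; fun_prop
  have h := hu.norm.bdd_mul (c := 2) hm.aestronglyMeasurable
    (Eventually.of_forall fun x => by
      have := weight_pos ((n : ℝ) + α) x
      rw [Real.norm_of_nonneg (by positivity)]
      exact one_add_rpow_le_weight_inv hs x)
  refine h.congr (Eventually.of_forall fun x => ?_)
  have hp : 0 < 1 + ‖x‖ ^ ((n : ℝ) + α) := by positivity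
  simp only [norm_div, Real.norm_of_nonneg hp.le]
  field_simp

lemma aestronglyMeasurable_of_inLalpha (hu : InLalpha n α u) : AEStronglyMeasurable u := by
  have hm : Measurable fun x : EuclideanSpace ℝ (Fin n) => 1 + ‖x‖ ^ ((n : ℝ) + α) := by fun_prop
  refine (hu.aestronglyMeasurable.mul hm.aestronglyMeasurable).congr
    (Eventually.of_forall fun x => ?_)
  have hp : 0 < 1 + ‖x‖ ^ ((n : ℝ) + α) := by positivity
  simp only [Pi.mul_apply]
  field_simp

lemma integral_mul_symFracLap_real [Nontrivial (EuclideanSpace ℝ (Fin n))] (hα0 : 0 < α)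
    (hα2 : α < 2) (hu : AlphaHarmonic n α u) {f : EuclideanSpace ℝ (Fin n) → ℝ}
    (hf : ContDiff ℝ ∞ f) (hc : HasCompactSupport f) :
    ∫ x, u x * symFracLap (n + α) f x = 0 := by
  have hd : (finrank ℝ (EuclideanSpace ℝ (Fin n)) : ℝ) = n := by simp
  obtain ⟨C, hC⟩ := exists_decaysWith (n + α) (hc.toSchwartzMap hf)
  have h := hu f hf hc (fun x => 2⁻¹ * symFracLap (n + α) f x) fun x =>
    hC.tendsto_principalValue (by rw [hd]; linarith) (by rw [hd]; linarith) x
  simp_rw [mul_left_comm _ (2⁻¹ : ℝ)] at h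
  rw [integral_const_mul] at h
  simpa using h

lemma integral_mul_symFracLap_complex [Nontrivial (EuclideanSpace ℝ (Fin n))] (hα0 : 0 < α)
    (hα2 : α < 2) (hu : AlphaHarmonic n α u) {f : EuclideanSpace ℝ (Fin n) → ℂ}
    (hf : ContDiff ℝ ∞ f) (hc : HasCompactSupport f) :
    ∫ x, (u x : ℂ) * symFracLap (n + α) f x = 0 := by
  have hd : (finrank ℝ (EuclideanSpace ℝ (Fin n)) : ℝ) = n := by simp
  by_cases hi : Integrable fun x => (u x : ℂ) * symFracLap (n + α) f x
  swap
  · exact integral_undef hi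
  obtain ⟨C, hC⟩ := exists_decaysWith (n + α) (hc.toSchwartzMap hf)
  have hint : ∀ x, Integrable fun y => (‖y‖ ^ ((n : ℝ) + α))⁻¹ • secondDiff f x y :=
    hC.integrable_smul_secondDiff (by rw [hd]; linarith) (by rw [hd]; linarith)
  have key : ∀ L : ℂ →L[ℝ] ℝ, L (∫ x, (u x : ℂ) * symFracLap (n + α) f x) = 0 := by
    intro L
    rw [← L.integral_comp_comm hi]
    have h := integral_mul_symFracLap_real hα0 hα2 hu (f := fun x => L (f x))
      (L.contDiff.comp hf) (hc.comp_left (g := L) (map_zero L))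
    rw [← h]
    congr 1 with x
    rw [symFracLap_clm_comp L (hint x), ← Complex.real_smul, map_smul, smul_eq_mul]
  exact Complex.ext (key Complex.reCLM) (key Complex.imCLM)

lemma integral_mul_symFracLap_schwartz [Nontrivial (EuclideanSpace ℝ (Fin n))] (hα0 : 0 < α)
    (hα2 : α < 2) (hu_L : InLalpha n α u) (hu : AlphaHarmonic n α u)
    (f : 𝓢(EuclideanSpace ℝ (Fin n), ℂ)) :
    ∫ x, (u x : ℂ) * symFracLap (n + α) f x = 0 := by
  have hd : (finrank ℝ (EuclideanSpace ℝ (Fin n)) : ℝ) = n := by simp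
  have h1 : (finrank ℝ (EuclideanSpace ℝ (Fin n)) : ℝ) < n + α := by rw [hd]; linarith
  have h2 : n + α < (finrank ℝ (EuclideanSpace ℝ (Fin n)) : ℝ) + 2 := by rw [hd]; linarith
  obtain ⟨C, g, hg, hgc, hgd, hlim⟩ := exists_cutoff_approximation (n + α) f
  have hum : AEStronglyMeasurable fun x => (u x : ℂ) :=
    Complex.continuous_ofReal.comp_aestronglyMeasurable (aestronglyMeasurable_of_inLalpha hu_L)
  have h := tendsto_integral_of_dominated_convergence
    (F := fun k x => (u x : ℂ) * symFracLap (n + α) (g k) x)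
    (f := fun x => (u x : ℂ) * symFracLap (n + α) f x) _
    (fun k => hum.mul
      (stronglyMeasurable_symFracLap (hg k).continuous).aestronglyMeasurable)
    ((integrable_mul_weight hα0 hu_L).const_mul _)
    (fun k => Eventually.of_forall fun x => by
      rw [norm_mul, Complex.norm_real, mul_left_comm]
      exact mul_le_mul_of_nonneg_left ((hgd k).norm_symFracLap_le h1 h2 x) (norm_nonneg _))
    (Eventually.of_forall fun x => (tendsto_symFracLap h1 h2 hgd hlim x).const_mul _)
  simp_rw [integral_mul_symFracLap_complex hα0 hα2 hu (hg _) (hgc _)] at h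
  exact tendsto_nhds_unique h tendsto_const_nhds |>.symm ▸ rfl

end Pairing

section SymbolIntegrand

variable {V : Type*} [NormedAddCommGroup V] [InnerProductSpace ℝ V] {s : ℝ}

lemma symbol_integrand_nonneg (ξ y : V) :
    0 ≤ (‖y‖ ^ s)⁻¹ * (2 - 2 * Real.cos (2 * Real.pi * ⟪ξ, y⟫)) :=
  mul_nonneg (by positivity) (by linarith [Real.cos_le_one (2 * Real.pi * ⟪ξ, y⟫)])

lemma symbol_integrand_le (ξ y : V) :
    (‖y‖ ^ s)⁻¹ * (2 - 2 * Real.cos (2 * Real.pi * ⟪ξ, y⟫)) ≤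
      (4 + (2 * Real.pi * ‖ξ‖) ^ 2) * truncKernel s y := by
  set t := 2 * Real.pi * ⟪ξ, y⟫ with ht
  have h1 : 2 - 2 * Real.cos t ≤ 4 := by linarith [Real.neg_one_le_cos t]
  have h2 : 2 - 2 * Real.cos t ≤ (2 * Real.pi * ‖ξ‖) ^ 2 * ‖y‖ ^ 2 := by
    have h3 := Real.one_sub_sq_div_two_le_cos (x := t)
    have h4 : t ^ 2 ≤ (2 * Real.pi * (‖ξ‖ * ‖y‖)) ^ 2 := by
      rw [ht, mul_pow, mul_pow _ (‖ξ‖ * ‖y‖)]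
      exact mul_le_mul_of_nonneg_left (sq_le_sq' (neg_le_of_abs_le (abs_real_inner_le_norm ξ y))
        (real_inner_le_norm ξ y)) (by positivity)
    nlinarith
  have h5 : 2 - 2 * Real.cos t ≤ (4 + (2 * Real.pi * ‖ξ‖) ^ 2) * min 1 (‖y‖ ^ 2) := by
    rcases min_choice 1 (‖y‖ ^ 2) with h | h <;> rw [h]
    · nlinarith [sq_nonneg (2 * Real.pi * ‖ξ‖)]
    · nlinarith [sq_nonneg ‖y‖]
  calc _ ≤ (‖y‖ ^ s)⁻¹ * ((4 + (2 * Real.pi * ‖ξ‖) ^ 2) * min 1 (‖y‖ ^ 2)) := by gcongr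
    _ = _ := by unfold truncKernel; ring

end SymbolIntegrand

section Symbol

variable {V : Type*} [NormedAddCommGroup V] [InnerProductSpace ℝ V] [FiniteDimensional ℝ V]
  [MeasurableSpace V] [BorelSpace V] {s : ℝ}

/-- The Fourier symbol of `symFracLap`. -/
def fracSymbol (s : ℝ) (ξ : V) : ℝ :=
  ∫ y, (‖y‖ ^ s)⁻¹ * (2 - 2 * Real.cos (2 * Real.pi * ⟪ξ, y⟫))

lemma integrable_symbol_integrand [Nontrivial V] (h1 : (finrank ℝ V : ℝ) < s)
    (h2 : s < finrank ℝ V + 2) (ξ : V) :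
    Integrable fun y => (‖y‖ ^ s)⁻¹ * (2 - 2 * Real.cos (2 * Real.pi * ⟪ξ, y⟫)) := by
  refine ((integrable_truncKernel h1 h2).const_mul (4 + (2 * Real.pi * ‖ξ‖) ^ 2)).mono'
    (Measurable.aestronglyMeasurable (by fun_prop)) (Eventually.of_forall fun y => ?_)
  rw [Real.norm_of_nonneg (symbol_integrand_nonneg ξ y)]
  exact symbol_integrand_le ξ y

lemma fracSymbol_pos [Nontrivial V] (h1 : (finrank ℝ V : ℝ) < s)
    (h2 : s < finrank ℝ V + 2) {ξ : V} (hξ : ξ ≠ 0) : 0 < fracSymbol s ξ := by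
  refine (integral_pos_iff_support_of_nonneg (symbol_integrand_nonneg ξ)
    (integrable_symbol_integrand h1 h2 ξ)).2 ?_
  have hopen : IsOpen {y : V | 0 < ⟪ξ, y⟫ ∧ ⟪ξ, y⟫ < 1} :=
    isOpen_Ioo.preimage (f := fun y : V => ⟪ξ, y⟫) (by fun_prop)
  have hne : {y : V | 0 < ⟪ξ, y⟫ ∧ ⟪ξ, y⟫ < 1}.Nonempty := by
    have hp : 0 < ‖ξ‖ ^ 2 := by positivity
    refine ⟨(2 * ‖ξ‖ ^ 2)⁻¹ • ξ, ?_⟩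
    have : ⟪ξ, (2 * ‖ξ‖ ^ 2)⁻¹ • ξ⟫ = 1 / 2 := by
      rw [real_inner_smul_right, real_inner_self_eq_norm_sq]; field_simp
    rw [mem_ofPred_eq, this]; norm_num
  refine (hopen.measure_pos volume hne).trans_le (measure_mono fun y hy => ?_)
  have hy0 : y ≠ 0 := by rintro rfl; simp at hy
  have hcos : Real.cos (2 * Real.pi * ⟪ξ, y⟫) ≠ 1 := by
    intro h
    obtain ⟨k, hk⟩ := (Real.cos_eq_one_iff _).1 h
    have hk' : (k : ℝ) = ⟪ξ, y⟫ := by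
      have := Real.pi_pos
      apply mul_right_cancel₀ (b := 2 * Real.pi) (by positivity)
      linarith
    rw [mem_ofPred_eq, ← hk'] at hy
    have ha : 0 < k := by exact_mod_cast hy.1
    have hb : k < 1 := by exact_mod_cast hy.2
    omega
  have : 0 < ‖y‖ ^ s := Real.rpow_pos_of_pos (norm_pos_iff.2 hy0) s
  refine mul_ne_zero (by positivity) fun h => hcos (by linarith)

lemma fracSymbol_eq_of_norm_eq {ξ η : V} (h : ‖ξ‖ = ‖η‖) : fracSymbol s ξ = fracSymbol s η := by
  set R := (ℝ ∙ (ξ - η))ᗮ.reflection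
  have hR : R ξ = η := Submodule.reflection_sub h
  have h := R.measurePreserving.integral_comp R.toHomeomorph.measurableEmbedding
    (fun y => (‖y‖ ^ s)⁻¹ * (2 - 2 * Real.cos (2 * Real.pi * ⟪R ξ, y⟫)))
  simp only [LinearIsometryEquiv.norm_map, LinearIsometryEquiv.inner_map_map] at h
  rw [← hR]
  exact h

lemma fracSymbol_smul {r : ℝ} (hr : 0 < r) (ξ : V) :
    fracSymbol s (r • ξ) = r ^ (s - finrank ℝ V) * fracSymbol s ξ := by
  have h := Measure.integral_comp_smul (volume : Measure V)
    (fun y => (‖y‖ ^ s)⁻¹ * (2 - 2 * Real.cos (2 * Real.pi * ⟪ξ, y⟫))) r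
  have e : ∀ y : V, (‖r • y‖ ^ s)⁻¹ * (2 - 2 * Real.cos (2 * Real.pi * ⟪ξ, r • y⟫)) =
      (r ^ s)⁻¹ * ((‖y‖ ^ s)⁻¹ * (2 - 2 * Real.cos (2 * Real.pi * ⟪r • ξ, y⟫))) := by
    intro y
    rw [norm_smul, Real.norm_of_nonneg hr.le, Real.mul_rpow hr.le (norm_nonneg y),
      real_inner_smul_left, real_inner_smul_right, mul_inv, mul_assoc]
  simp_rw [e] at h
  rw [integral_const_mul, abs_of_pos (by positivity), smul_eq_mul] at h
  have hrs : 0 < r ^ s := by positivity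
  rw [Real.rpow_sub hr, Real.rpow_natCast]
  unfold fracSymbol
  field_simp at h ⊢
  linarith

lemma exists_fracSymbol_eq [Nontrivial V] (h1 : (finrank ℝ V : ℝ) < s)
    (h2 : s < finrank ℝ V + 2) :
    ∃ c : ℝ, 0 < c ∧ ∀ ξ : V, ξ ≠ 0 → fracSymbol s ξ = c * ‖ξ‖ ^ (s - finrank ℝ V) := by
  obtain ⟨e, he⟩ := exists_norm_eq V zero_le_one
  refine ⟨fracSymbol s e, fracSymbol_pos h1 h2 (by rintro rfl; simp at he), fun ξ hξ => ?_⟩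
  rw [mul_comm, ← fracSymbol_smul (norm_pos_iff.2 hξ)]
  exact fracSymbol_eq_of_norm_eq (by simp [norm_smul, he])

lemma secondDiff_fourier {ψ : V → ℂ} (hψ : Integrable ψ) (x y : V) :
    secondDiff (𝓕 ψ) x y = ∫ v, Real.fourierChar (-⟪v, x⟫) •
      (((2 - 2 * Real.cos (2 * Real.pi * ⟪v, y⟫) : ℝ) : ℂ) * ψ v) := by
  have hi : ∀ w : V, Integrable fun v => Real.fourierChar (-⟪v, w⟫) • ψ v := fun w =>
    (Real.fourierIntegral_convergent_iff w).2 hψ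
  simp only [secondDiff, Real.fourier_eq]
  rw [← integral_sub (hi _) (hi _), ← integral_sub (hi _) (hi _),
    ← integral_add (f := fun v => Real.fourierChar (-⟪v, x⟫) • ψ v -
        Real.fourierChar (-⟪v, x + y⟫) • ψ v)
      (g := fun v => Real.fourierChar (-⟪v, x⟫) • ψ v -
        Real.fourierChar (-⟪v, x - y⟫) • ψ v) ((hi _).sub (hi _)) ((hi _).sub (hi _))]
  congr 1 with v
  simp only [Circle.smul_def, Real.fourierChar_apply, smul_eq_mul, inner_add_right,
    inner_sub_right]
  have ea : Complex.exp (↑(2 * Real.pi * -(⟪v, x⟫ + ⟪v, y⟫)) * Complex.I) =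
      Complex.exp (↑(2 * Real.pi * -⟪v, x⟫) * Complex.I) *
        Complex.exp (-↑(2 * Real.pi * ⟪v, y⟫) * Complex.I) := by
    rw [← Complex.exp_add]; push_cast; ring_nf
  have eb : Complex.exp (↑(2 * Real.pi * -(⟪v, x⟫ - ⟪v, y⟫)) * Complex.I) =
      Complex.exp (↑(2 * Real.pi * -⟪v, x⟫) * Complex.I) *
        Complex.exp (↑(2 * Real.pi * ⟪v, y⟫) * Complex.I) := by
    rw [← Complex.exp_add]; push_cast; ring_nf
  have ec : ((2 - 2 * Real.cos (2 * Real.pi * ⟪v, y⟫) : ℝ) : ℂ) =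
      2 - (Complex.exp (↑(2 * Real.pi * ⟪v, y⟫) * Complex.I) +
        Complex.exp (-↑(2 * Real.pi * ⟪v, y⟫) * Complex.I)) := by
    rw [Complex.ofReal_sub, Complex.ofReal_mul, Complex.ofReal_cos, Complex.cos,
      Complex.ofReal_ofNat]
    ring
  rw [ea, eb, ec]
  ring

/-- On Fourier transforms of compactly supported functions, `symFracLap` acts as a multiplier. -/
lemma symFracLap_fourier [Nontrivial V] (h1 : (finrank ℝ V : ℝ) < s)
    (h2 : s < finrank ℝ V + 2) {ψ : V → ℂ} (hψ : Continuous ψ) (hc : HasCompactSupport ψ)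
    (x : V) : symFracLap s (𝓕 ψ) x = 𝓕 (fun v => (fracSymbol s v : ℂ) * ψ v) x := by
  set A : V → V → ℂ := fun y v => (((‖y‖ ^ s)⁻¹ *
    (2 - 2 * Real.cos (2 * Real.pi * ⟪v, y⟫)) : ℝ) : ℂ) * (Real.fourierChar (-⟪v, x⟫) • ψ v)
    with hA
  have hleft : symFracLap s (𝓕 ψ) x = ∫ y, ∫ v, A y v := by
    unfold symFracLap
    congr 1 with y
    rw [secondDiff_fourier (hψ.integrable_of_hasCompactSupport hc), ← integral_smul]
    congr 1 with v
    simp only [hA, Circle.smul_def, smul_eq_mul, Complex.real_smul]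
    push_cast
    ring
  have hint : Integrable (uncurry A) (volume.prod volume) := by
    have hdom : Integrable fun v => (4 + (2 * Real.pi * ‖v‖) ^ 2) * ‖ψ v‖ :=
      Continuous.integrable_of_hasCompactSupport (by fun_prop) hc.norm.mul_left
    refine ((integrable_truncKernel h1 h2).mul_prod hdom).mono' ?_
      (Eventually.of_forall fun p => ?_)
    · have hk : Measurable fun p : V × V => (((‖p.1‖ ^ s)⁻¹ *
          (2 - 2 * Real.cos (2 * Real.pi * ⟪p.2, p.1⟫)) : ℝ) : ℂ) := by fun_prop
      have hv : Continuous fun p : V × V => Real.fourierChar (-⟪p.2, x⟫) • ψ p.2 := by fun_prop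
      exact hk.aestronglyMeasurable.mul hv.aestronglyMeasurable
    · simp only [uncurry, hA]
      rw [norm_mul, Complex.norm_real, Circle.norm_smul,
        Real.norm_of_nonneg (symbol_integrand_nonneg p.2 p.1), ← mul_assoc, mul_comm (truncKernel _ _)]
      exact mul_le_mul_of_nonneg_right (symbol_integrand_le p.2 p.1) (norm_nonneg _)
  rw [hleft, integral_integral_swap hint, Real.fourier_eq]
  congr 1 with v
  simp only [hA]
  rw [integral_mul_const, integral_complex_ofReal]
  simp only [fracSymbol, Circle.smul_def, smul_eq_mul]
  ring

end Symbol

lemma contDiff_mul_inv_norm_rpow {V : Type*} [NormedAddCommGroup V] [InnerProductSpace ℝ V]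
    {φ : V → ℝ} (hφ : ContDiff ℝ ∞ φ) (h0 : (0 : V) ∉ tsupport φ) (c α : ℝ) (hc : c ≠ 0) :
    ContDiff ℝ ∞ fun v => φ v * (c * ‖v‖ ^ α)⁻¹ := by
  refine contDiff_iff_contDiffAt.2 fun v => ?_
  by_cases hv : v ∈ tsupport φ
  · have hv0 : v ≠ 0 := by rintro rfl; exact h0 hv
    have hn : ‖v‖ ≠ 0 := norm_ne_zero_iff.2 hv0
    have hp : ‖v‖ ^ α ≠ 0 := (Real.rpow_pos_of_pos (norm_pos_iff.2 hv0) α).ne'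
    exact hφ.contDiffAt.mul
      ((contDiffAt_const.mul ((contDiffAt_norm ℝ hv0).rpow_const_of_ne hn)).inv
        (mul_ne_zero hc hp))
  · refine (contDiffAt_const (c := (0 : ℝ))).congr_of_eventuallyEq ?_
    filter_upwards [notMem_tsupport_iff_eventuallyEq.1 hv] with w hw
    simp [hw]

end FractionalLaplacian

/-- The Fourier transform of an `α`-harmonic `u ∈ L_α` (as a tempered distribution)
is supported at the origin: `∫ u(x) 𝓕(φ)(x) dx = 0` whenever `φ ∈ C_c^∞` and
`0 ∉ supp φ`. -/
theorem fourier_transform_supported_at_origin (n : ℕ) (hn : 1 ≤ n) (α : ℝ)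
    (hα0 : 0 < α) (hα2 : α < 2)
    (u : EuclideanSpace ℝ (Fin n) → ℝ)
    (hu_L : InLalpha n α u) (hu_harm : AlphaHarmonic n α u) :
    ∀ φ : EuclideanSpace ℝ (Fin n) → ℝ, ContDiff ℝ (⊤ : ℕ∞) φ → HasCompactSupport φ →
      (0 : EuclideanSpace ℝ (Fin n)) ∉ tsupport φ →
      ∫ x : EuclideanSpace ℝ (Fin n),
        (u x : ℂ) * 𝓕 (fun y : EuclideanSpace ℝ (Fin n) => ((φ y : ℝ) : ℂ)) x = 0 := by
  intro φ hφ hφc h0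
  have hd : (Module.finrank ℝ (EuclideanSpace ℝ (Fin n)) : ℝ) = n := by simp
  have h1 : (Module.finrank ℝ (EuclideanSpace ℝ (Fin n)) : ℝ) < n + α := by rw [hd]; linarith
  have h2 : n + α < (Module.finrank ℝ (EuclideanSpace ℝ (Fin n)) : ℝ) + 2 := by
    rw [hd]; linarith
  have : Nontrivial (EuclideanSpace ℝ (Fin n)) :=
    Module.nontrivial_of_finrank_pos (R := ℝ) (by simp; omega)
  obtain ⟨c, hc, hsym⟩ := FractionalLaplacian.exists_fracSymbol_eq (V := EuclideanSpace ℝ (Fin n)) h1 h2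
  rw [hd, add_sub_cancel_left] at hsym
  set ψ : EuclideanSpace ℝ (Fin n) → ℂ := fun v => ((φ v * (c * ‖v‖ ^ α)⁻¹ : ℝ) : ℂ) with hψ
  have hψs : ContDiff ℝ (⊤ : ℕ∞) ψ :=
    Complex.ofRealCLM.contDiff.comp (FractionalLaplacian.contDiff_mul_inv_norm_rpow hφ h0 c α hc.ne')
  have hψc : HasCompactSupport ψ :=
    (hφc.mul_right (f' := fun v => (c * ‖v‖ ^ α)⁻¹)).comp_left Complex.ofReal_zero
  have hmul : (fun v => (FractionalLaplacian.fracSymbol (n + α) v : ℂ) * ψ v) = fun v => (φ v : ℂ) := by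
    funext v
    by_cases hv : v = 0
    · subst hv
      simp [hψ, image_eq_zero_of_notMem_tsupport h0]
    · have : 0 < ‖v‖ ^ α := Real.rpow_pos_of_pos (norm_pos_iff.2 hv) α
      rw [hsym v hv, hψ, ← Complex.ofReal_mul]
      congr 1
      field_simp
  have h := FractionalLaplacian.integral_mul_symFracLap_schwartz hα0 hα2 hu_L hu_harm (𝓕 (hψc.toSchwartzMap hψs))
  have hcoe : ⇑(𝓕 (hψc.toSchwartzMap hψs) : SchwartzMap (EuclideanSpace ℝ (Fin n)) ℂ) = 𝓕 ψ := rfl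
  simp_rw [hcoe, FractionalLaplacian.symFracLap_fourier h1 h2 hψs.continuous hψc, hmul] at h
  exact h
end
end

section
/- Let n ≥ 1 and 0 < α < min(2, n). There exists a constant c_{n,α} > 0, depending only on n and α, such that for every Schwartz function φ on ℝⁿ and every x ∈ ℝⁿ, ∫_{ℝⁿ} |x - y|^{α - n} · (lim_{ε→0⁺} ∫_{{z : |y-z| > ε}} (φ(y) - φ(z))/|y-z|^{n+α} dz) dy = c_{n,α} φ(x); that is, the Riesz kernel |x - y|^{α-n} is (up to a constant) the fundamental solution of the fractional Laplacian. -/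
open MeasureTheory Filter Topology Metric

noncomputable section

open Module FourierTransform Real
open scoped SchwartzMap InnerProductSpace

namespace RieszKernel

lemma one_sub_cos_inner_le {E : Type*} [NormedAddCommGroup E] [InnerProductSpace ℝ E]
    (h ξ : E) :
    1 - cos (2 * π * ⟪h, ξ⟫_ℝ) ≤ 20 * (1 + ‖ξ‖ ^ 2) * min 1 (‖h‖ ^ 2) := by
  rcases min_cases 1 (‖h‖ ^ 2) with ⟨h1, h2⟩ | ⟨h1, h2⟩
  · rw [h1]
    nlinarith [neg_one_le_cos (2 * π * ⟪h, ξ⟫_ℝ), sq_nonneg ‖ξ‖]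
  · rw [h1]
    have hc := one_sub_sq_div_two_le_cos (x := 2 * π * ⟪h, ξ⟫_ℝ)
    have hi : ⟪h, ξ⟫_ℝ ^ 2 ≤ (‖h‖ * ‖ξ‖) ^ 2 :=
      sq_le_sq.2 ((abs_real_inner_le_norm h ξ).trans (le_abs_self _))
    have hpi : π ^ 2 ≤ 10 := by nlinarith [pi_lt_d2, pi_pos]
    have h3 : (2 * π * ⟪h, ξ⟫_ℝ) ^ 2 / 2 ≤ 2 * 10 * (‖h‖ * ‖ξ‖) ^ 2 := by
      have : π ^ 2 * ⟪h, ξ⟫_ℝ ^ 2 ≤ 10 * (‖h‖ * ‖ξ‖) ^ 2 := by gcongr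
      linarith [this]
    nlinarith [sq_nonneg ‖h‖]

variable {V : Type*} [NormedAddCommGroup V] [InnerProductSpace ℝ V] [FiniteDimensional ℝ V]
  [MeasurableSpace V] [BorelSpace V]

section LevySymbol

variable {α : ℝ}

lemma integrable_min_sq_mul_rpow_norm [Nontrivial V] (hα0 : 0 < α) (hα2 : α < 2) :
    Integrable (fun h : V => min 1 (‖h‖ ^ 2) * ‖h‖ ^ (-(finrank ℝ V + α))) := by
  have hd : 1 ≤ finrank ℝ V := finrank_pos
  have key : ∀ y : ℝ, 0 < y →
      y ^ (finrank ℝ V - 1) • (min 1 (y ^ 2) * y ^ (-(finrank ℝ V + α)))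
        = min 1 (y ^ 2) * y ^ (-1 - α) := by
    intro y hy
    have : y ^ (-1 - α) = y ^ (finrank ℝ V - 1) * y ^ (-(finrank ℝ V + α)) := by
      rw [← rpow_natCast, ← rpow_add hy]
      congr 1
      push_cast [Nat.cast_sub hd]
      ring
    rw [this, smul_eq_mul]
    ring
  rw [integrable_fun_norm_addHaar volume
    (f := fun y : ℝ => min 1 (y ^ 2) * y ^ (-(finrank ℝ V + α)))]
  refine IntegrableOn.congr_fun (f := fun y : ℝ => min 1 (y ^ 2) * y ^ (-1 - α)) ?_
    (fun y hy => (key y hy).symm) measurableSet_Ioi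
  rw [← Set.Ioo_union_Ici_eq_Ioi (zero_lt_one' ℝ), integrableOn_union]
  constructor
  · refine ((intervalIntegral.integrableOn_Ioo_rpow_iff (s := 1 - α) one_pos).2
      (by linarith)).congr_fun (fun y hy => ?_) measurableSet_Ioo
    have h1 : y ^ 2 ≤ 1 := by nlinarith [hy.1, hy.2]
    simp only [min_eq_right h1]
    rw [← rpow_natCast, ← rpow_add hy.1]
    norm_num
    ring_nf
  · rw [integrableOn_Ici_iff_integrableOn_Ioi]
    refine (integrableOn_Ioi_rpow_of_lt (a := -1 - α) (by linarith) one_pos).congr_fun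
      (fun y hy => ?_) measurableSet_Ioi
    have h1 : 1 ≤ y ^ 2 := by nlinarith [Set.mem_Ioi.1 hy]
    simp [min_eq_left h1]

lemma integrable_one_sub_cos_mul_rpow_norm [Nontrivial V] (hα0 : 0 < α) (hα2 : α < 2) (ξ : V) :
    Integrable (fun h : V => (1 - cos (2 * π * ⟪h, ξ⟫_ℝ)) * ‖h‖ ^ (-(finrank ℝ V + α))) := by
  refine ((integrable_min_sq_mul_rpow_norm hα0 hα2).const_mul (20 * (1 + ‖ξ‖ ^ 2))).mono'
    (by fun_prop) (ae_of_all _ fun h => ?_)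
  have h0 : 0 ≤ 1 - cos (2 * π * ⟪h, ξ⟫_ℝ) := sub_nonneg.2 (cos_le_one _)
  rw [Real.norm_of_nonneg (by positivity), ← mul_assoc]
  gcongr
  exact one_sub_cos_inner_le h ξ

lemma integral_one_sub_cos_eq_of_norm_eq {ξ η : V} (hn : ‖ξ‖ = ‖η‖) :
    ∫ h : V, (1 - cos (2 * π * ⟪h, ξ⟫_ℝ)) * ‖h‖ ^ (-(finrank ℝ V + α))
      = ∫ h : V, (1 - cos (2 * π * ⟪h, η⟫_ℝ)) * ‖h‖ ^ (-(finrank ℝ V + α)) := by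
  set e : V ≃ₗᵢ[ℝ] V := (ℝ ∙ (ξ - η))ᗮ.reflection
  have he : e ξ = η := Submodule.reflection_sub hn
  symm
  rw [← e.measurePreserving.integral_comp e.toHomeomorph.measurableEmbedding]
  simp only [← he, LinearIsometryEquiv.inner_map_map, LinearIsometryEquiv.norm_map]

lemma integral_one_sub_cos_smul {r : ℝ} (hr : 0 < r) (ξ : V) :
    ∫ h : V, (1 - cos (2 * π * ⟪h, r • ξ⟫_ℝ)) * ‖h‖ ^ (-(finrank ℝ V + α))
      = r ^ α * ∫ h : V, (1 - cos (2 * π * ⟪h, ξ⟫_ℝ)) * ‖h‖ ^ (-(finrank ℝ V + α)) := by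
  set F : V → ℝ := fun h => (1 - cos (2 * π * ⟪h, ξ⟫_ℝ)) * ‖h‖ ^ (-(finrank ℝ V + α)) with hF
  have h1 : ∀ h : V, (1 - cos (2 * π * ⟪h, r • ξ⟫_ℝ)) * ‖h‖ ^ (-(finrank ℝ V + α))
      = r ^ (finrank ℝ V + α) * F (r • h) := by
    intro h
    simp only [hF, norm_smul, Real.norm_of_nonneg hr.le, inner_smul_left, inner_smul_right,
      conj_trivial]
    rw [mul_rpow hr.le (norm_nonneg _), rpow_neg hr.le]
    have := (rpow_pos_of_pos hr (finrank ℝ V + α)).ne'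
    field_simp
  simp_rw [h1]
  rw [integral_const_mul, Measure.integral_comp_smul, abs_of_pos (by positivity), smul_eq_mul,
    rpow_add hr, rpow_natCast]
  field_simp

/-- The Lévy symbol of the `α`-stable kernel is a positive multiple of `‖ξ‖ ^ α`. -/
lemma exists_integral_one_sub_cos_eq [Nontrivial V] (hα0 : 0 < α) (hα2 : α < 2) :
    ∃ C : ℝ, 0 < C ∧ ∀ ξ : V,
      ∫ h : V, (1 - cos (2 * π * ⟪h, ξ⟫_ℝ)) * ‖h‖ ^ (-(finrank ℝ V + α)) = C * ‖ξ‖ ^ α := by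
  obtain ⟨e, he⟩ := exists_norm_eq V zero_le_one
  have he0 : e ≠ 0 := by
    rintro rfl
    simp at he
  refine ⟨∫ h : V, (1 - cos (2 * π * ⟪h, e⟫_ℝ)) * ‖h‖ ^ (-(finrank ℝ V + α)), ?_, fun ξ => ?_⟩
  · rw [integral_pos_iff_support_of_nonneg _ (integrable_one_sub_cos_mul_rpow_norm hα0 hα2 e)]
    · have ho : IsOpen {h : V | h ≠ 0 ∧ cos (2 * π * ⟪h, e⟫_ℝ) < 1} :=
        isOpen_ne.inter (isOpen_lt
          (by fun_prop : Continuous fun h : V => cos (2 * π * ⟪h, e⟫_ℝ)) continuous_const)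
      refine (ho.measure_pos volume ⟨(1 / 2 : ℝ) • e, smul_ne_zero (by norm_num) he0, ?_⟩).trans_le
        (measure_mono fun h hh => ?_)
      · have : 2 * π * ⟪(1 / 2 : ℝ) • e, e⟫_ℝ = π := by
          rw [inner_smul_left, real_inner_self_eq_norm_sq, he, conj_trivial]
          ring
        rw [this, cos_pi]
        norm_num
      · exact mul_ne_zero (sub_pos.2 hh.2).ne' (rpow_pos_of_pos (norm_pos_iff.2 hh.1) _).ne'
    · exact fun h => mul_nonneg (sub_nonneg.2 (cos_le_one _)) (by positivity)
  · rcases eq_or_ne ξ 0 with rfl | hξ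
    · simp [zero_rpow hα0.ne']
    · have hn : ‖ξ‖ = ‖(‖ξ‖ • e)‖ := by simp [norm_smul, he]
      rw [integral_one_sub_cos_eq_of_norm_eq hn,
        integral_one_sub_cos_smul (norm_pos_iff.2 hξ), mul_comm]

end LevySymbol

section SecondDifference

/-- The symmetric second difference `2 f(y) - f(y + h) - f(y - h)`. -/
def secondDiff {E : Type*} [AddGroup E] (f : E → ℝ) (y h : E) : ℝ :=
  2 * f y - f (y + h) - f (y - h)

lemma continuous_uncurry_secondDiff {E : Type*} [AddGroup E] [TopologicalSpace E]
    [IsTopologicalAddGroup E] {f : E → ℝ} (hf : Continuous f) :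
    Continuous (Function.uncurry (secondDiff f)) := by
  unfold secondDiff Function.uncurry
  fun_prop

variable {α : ℝ} (φ : 𝓢(V, ℝ))

lemma integrable_secondDiff (h : V) : Integrable fun y => secondDiff φ y h :=
  ((φ.integrable.const_mul 2).sub (φ.integrable.comp_add_right h)).sub
    (φ.integrable.comp_sub_right h)

lemma exists_abs_secondDiff_le {E : Type*} [NormedAddCommGroup E] [InnerProductSpace ℝ E]
    (φ : 𝓢(E, ℝ)) :
    ∃ C : ℝ, 0 ≤ C ∧ ∀ y h : E, ‖h‖ ≤ 1 →
      |secondDiff φ y h| ≤ C * ‖h‖ ^ 2 * (1 + ‖y‖) ^ (-(finrank ℝ E + 1 : ℝ)) := by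
  set φ₁ : 𝓢(E, E →L[ℝ] ℝ) := SchwartzMap.fderivCLM ℝ E ℝ φ
  set φ₂ : 𝓢(E, E →L[ℝ] E →L[ℝ] ℝ) := SchwartzMap.fderivCLM ℝ E (E →L[ℝ] ℝ) φ₁
  have hφ₁ : ∀ z, HasFDerivAt φ (φ₁ z) z := fun z => φ.differentiableAt.hasFDerivAt
  have hφ₂ : ∀ z, HasFDerivAt φ₁ (φ₂ z) z := fun z => φ₁.differentiableAt.hasFDerivAt
  set m := finrank ℝ E + 1 with hm
  obtain ⟨C, hC⟩ : ∃ C : ℝ, ∀ z, (1 + ‖z‖) ^ m * ‖φ₂ z‖ ≤ C := by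
    have := SchwartzMap.one_add_le_sup_seminorm_apply (𝕜 := ℝ) (m := (m, 0)) le_rfl le_rfl φ₂
    simp only [norm_iteratedFDeriv_zero] at this
    exact ⟨_, this⟩
  have hC0 : 0 ≤ C := le_trans (by positivity) (hC 0)
  refine ⟨2 * (2 ^ m * C), by positivity, fun y h hh => ?_⟩
  have hcast : (1 + ‖y‖) ^ (-(finrank ℝ E + 1 : ℝ)) = ((1 + ‖y‖) ^ m)⁻¹ := by
    rw [rpow_neg (by positivity), ← rpow_natCast]
    simp [hm]
  rw [hcast]
  set M := 2 ^ m * C * ((1 + ‖y‖) ^ m)⁻¹ with hM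
  have hM0 : 0 ≤ M := by positivity
  have hbound : ∀ z ∈ closedBall y 1, ‖φ₂ z‖ ≤ M := by
    intro z hz
    have h1 : 1 + ‖y‖ ≤ 2 * (1 + ‖z‖) := by
      have := norm_le_norm_add_norm_sub' y z
      rw [mem_closedBall, dist_comm, dist_eq_norm] at hz
      linarith [norm_nonneg z]
    have h2 : (1 + ‖y‖) ^ m ≤ 2 ^ m * (1 + ‖z‖) ^ m := by
      rw [← mul_pow]
      gcongr
    rw [hM, ← div_eq_mul_inv, le_div_iff₀ (by positivity)]
    calc ‖φ₂ z‖ * (1 + ‖y‖) ^ m ≤ ‖φ₂ z‖ * (2 ^ m * (1 + ‖z‖) ^ m) := by gcongr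
      _ = 2 ^ m * ((1 + ‖z‖) ^ m * ‖φ₂ z‖) := by ring
      _ ≤ 2 ^ m * C := by gcongr; exact hC z
  have hlip : ∀ k : E, ‖k‖ ≤ ‖h‖ → ‖φ₁ (y + k) - φ₁ (y - k)‖ ≤ 2 * M * ‖h‖ := by
    intro k hk
    refine ((convex_closedBall y 1).norm_image_sub_le_of_norm_hasFDerivWithin_le
      (fun z _ => (hφ₂ z).hasFDerivWithinAt) hbound (x := y - k) (y := y + k) ?_ ?_).trans ?_
    · simpa using hk.trans hh
    · simpa using hk.trans hh
    · have : ‖y + k - (y - k)‖ ≤ 2 * ‖h‖ := by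
        rw [add_sub_sub_cancel]
        linarith [norm_add_le k k]
      calc M * ‖y + k - (y - k)‖ ≤ M * (2 * ‖h‖) := by gcongr
        _ = _ := by ring
  have hderiv : ∀ k : E, HasFDerivAt (fun k => φ (y + k) + φ (y - k))
      (φ₁ (y + k) - φ₁ (y - k)) k := by
    intro k
    have h1 := (hφ₁ (y + k)).comp k ((hasFDerivAt_id k).const_add y)
    have h2 := (hφ₁ (y - k)).comp k ((hasFDerivAt_id k).const_sub y)
    refine (h1.add h2).congr_fderiv ?_
    ext v
    simp [sub_eq_add_neg]
  have := (convex_closedBall (0 : E) ‖h‖).norm_image_sub_le_of_norm_hasFDerivWithin_le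
    (fun k _ => (hderiv k).hasFDerivWithinAt)
    (fun k hk => hlip k (by simpa using hk)) (x := 0) (y := h) (by simp) (by simp)
  rw [Real.norm_eq_abs] at this
  have heq : secondDiff φ y h = -(φ (y + h) + φ (y - h) - (φ (y + 0) + φ (y - 0))) := by
    simp only [secondDiff, add_zero, sub_zero]
    ring
  rw [heq, abs_neg]
  refine this.trans (le_of_eq ?_)
  rw [hM, sub_zero]
  ring

lemma exists_abs_secondDiff_le_min {E : Type*} [NormedAddCommGroup E] [InnerProductSpace ℝ E]
    (φ : 𝓢(E, ℝ)) :
    ∃ C : ℝ, ∀ y h : E, |secondDiff φ y h| ≤ C * min 1 (‖h‖ ^ 2) := by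
  obtain ⟨C, hC0, hC⟩ := exists_abs_secondDiff_le φ
  obtain ⟨B, hB0, hB⟩ := φ.decay 0 0
  simp only [pow_zero, one_mul, norm_iteratedFDeriv_zero, Real.norm_eq_abs] at hB
  refine ⟨max C (4 * B), fun y h => ?_⟩
  rcases le_total ‖h‖ 1 with h1 | h1
  · rw [min_eq_right (pow_le_one₀ (norm_nonneg _) h1)]
    have h2 : (1 + ‖y‖) ^ (-(finrank ℝ E + 1 : ℝ)) ≤ 1 :=
      rpow_le_one_of_one_le_of_nonpos (by simp) (by linarith [(finrank ℝ E).cast_nonneg (α := ℝ)])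
    calc _ ≤ _ := hC y h h1
      _ ≤ C * ‖h‖ ^ 2 * 1 := by gcongr
      _ ≤ _ := by rw [mul_one]; gcongr; exact le_max_left _ _
  · rw [min_eq_left (one_le_pow₀ h1), mul_one]
    refine le_trans ?_ (le_max_right _ _)
    have := abs_le.1 (hB y)
    have := abs_le.1 (hB (y + h))
    have := abs_le.1 (hB (y - h))
    rw [secondDiff, abs_le]
    constructor <;> linarith

lemma exists_integral_abs_secondDiff_le_min :
    ∃ C : ℝ, ∀ h : V, ∫ y, |secondDiff φ y h| ≤ C * min 1 (‖h‖ ^ 2) := by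
  obtain ⟨C, hC0, hC⟩ := exists_abs_secondDiff_le φ
  have hint : Integrable fun y : V => (1 + ‖y‖) ^ (-(finrank ℝ V + 1 : ℝ)) :=
    integrable_one_add_norm (by linarith)
  refine ⟨max (C * ∫ y : V, (1 + ‖y‖) ^ (-(finrank ℝ V + 1 : ℝ))) (4 * ∫ y, |φ y|), fun h => ?_⟩
  rcases le_total ‖h‖ 1 with h1 | h1
  · rw [min_eq_right (pow_le_one₀ (norm_nonneg _) h1)]
    calc _ ≤ ∫ y : V, C * ‖h‖ ^ 2 * (1 + ‖y‖) ^ (-(finrank ℝ V + 1 : ℝ)) :=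
          integral_mono (integrable_secondDiff φ h).abs (hint.const_mul _) fun y => hC y h h1
      _ = (C * ∫ y : V, (1 + ‖y‖) ^ (-(finrank ℝ V + 1 : ℝ))) * ‖h‖ ^ 2 := by
          rw [integral_const_mul]; ring
      _ ≤ _ := by gcongr; exact le_max_left _ _
  · rw [min_eq_left (one_le_pow₀ h1), mul_one]
    refine le_trans ?_ (le_max_right _ _)
    have i0 := φ.integrable (μ := volume).abs
    have i1 := i0.comp_add_right h
    have i2 := i0.comp_sub_right h
    calc _ ≤ ∫ y, (2 * |φ y| + |φ (y + h)| + |φ (y - h)|) := by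
          refine integral_mono (integrable_secondDiff φ h).abs (((i0.const_mul 2).add i1).add i2)
            fun y => ?_
          simp only [secondDiff]
          refine (abs_sub _ _).trans (add_le_add_left ((abs_sub _ _).trans ?_) _)
          rw [abs_mul, abs_two]
      _ = _ := by
          rw [integral_add (f := fun y => 2 * |φ y| + |φ (y + h)|) ((i0.const_mul 2).add i1) i2,
            integral_add (i0.const_mul 2) i1,
            integral_const_mul, integral_add_right_eq_self (fun y => |φ y|),
            integral_sub_right_eq_self (fun y => |φ y|)]
          ring

lemma integrable_secondDiff_mul_rpow_norm [Nontrivial V] (hα0 : 0 < α) (hα2 : α < 2) (y : V) :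
    Integrable fun h => secondDiff φ y h * ‖h‖ ^ (-(finrank ℝ V + α)) := by
  obtain ⟨C, hC⟩ := exists_abs_secondDiff_le_min φ
  have hc : Continuous (secondDiff φ y) :=
    (continuous_uncurry_secondDiff φ.continuous).comp (Continuous.prodMk_right y)
  refine ((integrable_min_sq_mul_rpow_norm hα0 hα2).const_mul C).mono'
    (hc.aestronglyMeasurable.mul (measurable_norm.pow_const _).aestronglyMeasurable)
    (ae_of_all _ fun h => ?_)
  rw [norm_mul, Real.norm_eq_abs, Real.norm_of_nonneg (by positivity), ← mul_assoc]
  gcongr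
  exact hC y h

lemma integrable_uncurry_secondDiff_mul_rpow_norm [Nontrivial V] (hα0 : 0 < α) (hα2 : α < 2) :
    Integrable (fun p : V × V => secondDiff φ p.1 p.2 * ‖p.2‖ ^ (-(finrank ℝ V + α)))
      (volume.prod volume) := by
  have hmeas : AEStronglyMeasurable
      (fun p : V × V => secondDiff φ p.1 p.2 * ‖p.2‖ ^ (-(finrank ℝ V + α)))
      (volume.prod volume) :=
    (continuous_uncurry_secondDiff φ.continuous).aestronglyMeasurable.mul
      (measurable_snd.norm.pow_const _).aestronglyMeasurable
  obtain ⟨C, hC⟩ := exists_integral_abs_secondDiff_le_min φ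
  refine (integrable_prod_iff' hmeas).2 ⟨ae_of_all _ fun h =>
    (integrable_secondDiff φ h).mul_const (‖h‖ ^ (-(finrank ℝ V + α))), ?_⟩
  refine ((integrable_min_sq_mul_rpow_norm hα0 hα2).const_mul C).mono'
    hmeas.norm.prod_swap.integral_prod_right' (ae_of_all _ fun h => ?_)
  rw [Real.norm_of_nonneg (by positivity)]
  simp only [norm_mul, Real.norm_of_nonneg (rpow_nonneg (norm_nonneg h) _),
    Real.norm_eq_abs (secondDiff _ _ _)]
  rw [integral_mul_const, ← mul_assoc]
  gcongr
  exact hC h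

/-- The principal-value integral is half the absolutely convergent second-difference integral. -/
lemma eq_integral_secondDiff_of_tendsto [Nontrivial V] (hα0 : 0 < α) (hα2 : α < 2) {y : V} {L : ℝ}
    (hL : Tendsto (fun ε : ℝ => ∫ z in {z : V | ε < ‖y - z‖},
      (φ y - φ z) / ‖y - z‖ ^ (finrank ℝ V + α)) (𝓝[>] 0) (𝓝 L)) :
    L = 2⁻¹ * ∫ h, secondDiff φ y h * ‖h‖ ^ (-(finrank ℝ V + α)) := by
  set s : ℝ → Set V := fun ε => {h : V | ε < ‖h‖}
  have hs : ∀ ε, MeasurableSet (s ε) := fun ε =>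
    (isOpen_lt continuous_const continuous_norm).measurableSet
  have hlim : Tendsto (fun ε : ℝ => 2⁻¹ * ∫ h, (s ε).indicator
      (fun h => secondDiff φ y h * ‖h‖ ^ (-(finrank ℝ V + α))) h) (𝓝[>] 0)
      (𝓝 (2⁻¹ * ∫ h, secondDiff φ y h * ‖h‖ ^ (-(finrank ℝ V + α)))) := by
    have hi := integrable_secondDiff_mul_rpow_norm φ hα0 hα2 y
    refine (tendsto_integral_filter_of_dominated_convergence _
      (Eventually.of_forall fun ε => hi.aestronglyMeasurable.indicator (hs ε))
      (Eventually.of_forall fun ε => ae_of_all _ fun h => norm_indicator_le_norm_self _ _)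
      hi.norm ?_).const_mul _
    have h0 : ∀ᵐ h : V, h ≠ 0 := by simp [ae_iff]
    filter_upwards [h0] with h hh
    refine tendsto_const_nhds.congr' ?_
    have : ∀ᶠ ε in 𝓝[>] (0 : ℝ), ε < ‖h‖ :=
      nhdsWithin_le_nhds (eventually_lt_nhds (norm_pos_iff.2 hh))
    filter_upwards [this] with ε hε
    rw [Set.indicator_of_mem (show h ∈ s ε from hε)]
  refine tendsto_nhds_unique (hL.congr' ?_) hlim
  filter_upwards [self_mem_nhdsWithin] with ε hε
  obtain ⟨B, hB0, hB⟩ := φ.decay 0 0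
  simp only [pow_zero, one_mul, norm_iteratedFDeriv_zero, Real.norm_eq_abs] at hB
  set F : V → ℝ := (s ε).indicator fun h => (φ y - φ (y - h)) * ‖h‖ ^ (-(finrank ℝ V + α)) with hF
  have hε0 : 0 < ε := hε
  have hδ : 0 < min 1 (ε ^ 2) := lt_min one_pos (by positivity)
  have hFint : Integrable F := by
    have hc : Continuous fun h => φ y - φ (y - h) := by
      have := φ.continuous
      fun_prop
    refine ((integrable_min_sq_mul_rpow_norm hα0 hα2).const_mul (2 * B / min 1 (ε ^ 2))).mono'
      ((hc.aestronglyMeasurable.mul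
        (measurable_norm.pow_const _).aestronglyMeasurable).indicator (hs ε))
      (ae_of_all _ fun h => ?_)
    rw [hF, Set.indicator_apply]
    split_ifs with hh
    · have hh' : ε < ‖h‖ := hh
      rw [norm_mul, Real.norm_of_nonneg (rpow_nonneg (norm_nonneg h) _), ← mul_assoc]
      gcongr
      calc ‖φ y - φ (y - h)‖ ≤ |φ y| + |φ (y - h)| := abs_sub _ _
        _ ≤ 2 * B := by linarith [hB y, hB (y - h)]
        _ = 2 * B / min 1 (ε ^ 2) * min 1 (ε ^ 2) := by field_simp
        _ ≤ _ := by gcongr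
    · rw [norm_zero]
      positivity
  have h1 : ∫ z in {z : V | ε < ‖y - z‖}, (φ y - φ z) / ‖y - z‖ ^ (finrank ℝ V + α)
      = ∫ h, F h := by
    rw [← integral_sub_left_eq_self F volume y, ← integral_indicator
      (isOpen_lt continuous_const (by fun_prop)).measurableSet]
    congr 1
    ext z
    simp only [hF, Set.indicator_apply, Set.mem_ofPred_eq, s, sub_sub_cancel,
      rpow_neg (norm_nonneg _), div_eq_mul_inv]
  have h2 : ∀ h, (s ε).indicator
      (fun h => secondDiff φ y h * ‖h‖ ^ (-(finrank ℝ V + α))) h = F h + F (-h) := by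
    intro h
    simp only [hF, Set.indicator_apply, Set.mem_ofPred_eq, s, norm_neg, sub_neg_eq_add, secondDiff]
    split_ifs <;> ring
  rw [h1, integral_congr_ae (ae_of_all _ h2), integral_add hFint hFint.comp_neg,
    integral_neg_eq_self]
  ring

end SecondDifference

section FourierSide

variable {α : ℝ}

lemma ofReal_secondDiff_eq_integral (φ : 𝓢(V, ℝ)) {ψ : V → ℂ} (hψ : Integrable ψ)
    (hφψ : ∀ y, (φ y : ℂ) = 𝓕 ψ y) (y h : V) :
    (secondDiff φ y h : ℂ) = ∫ ξ, ((2 * (1 - cos (2 * π * ⟪h, ξ⟫_ℝ)) : ℝ) : ℂ) *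
      (Complex.exp (↑(-2 * π * ⟪ξ, y⟫_ℝ) * Complex.I) * ψ ξ) := by
  have hi : ∀ z : V, Integrable fun ξ => Complex.exp (↑(-2 * π * ⟪ξ, z⟫_ℝ) * Complex.I) * ψ ξ := by
    intro z
    refine hψ.norm.mono' (AEStronglyMeasurable.mul (by fun_prop) hψ.aestronglyMeasurable)
      (ae_of_all _ fun ξ => ?_)
    rw [norm_mul, Complex.norm_exp_ofReal_mul_I, one_mul]
  have h0 : (secondDiff φ y h : ℂ) = 2 * 𝓕 ψ y - 𝓕 ψ (y + h) - 𝓕 ψ (y - h) := by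
    simp [secondDiff, hφψ]
  simp only [h0, Real.fourier_eq', smul_eq_mul]
  have hi' : Integrable fun ξ => 2 * (Complex.exp (↑(-2 * π * ⟪ξ, y⟫_ℝ) * Complex.I) * ψ ξ)
      - Complex.exp (↑(-2 * π * ⟪ξ, y + h⟫_ℝ) * Complex.I) * ψ ξ :=
    ((hi y).const_mul 2).sub (hi _)
  rw [← integral_const_mul, ← integral_sub ((hi y).const_mul 2) (hi _), ← integral_sub hi' (hi _)]
  congr 1
  ext ξ
  have h1 : Complex.exp (↑(-2 * π * ⟪ξ, y + h⟫_ℝ) * Complex.I)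
      = Complex.exp (↑(-2 * π * ⟪ξ, y⟫_ℝ) * Complex.I) *
        Complex.exp (-(↑(2 * π * ⟪h, ξ⟫_ℝ) * Complex.I)) := by
    rw [← Complex.exp_add, inner_add_right, real_inner_comm h ξ]
    congr 1
    push_cast
    ring
  have h2 : Complex.exp (↑(-2 * π * ⟪ξ, y - h⟫_ℝ) * Complex.I)
      = Complex.exp (↑(-2 * π * ⟪ξ, y⟫_ℝ) * Complex.I) *
        Complex.exp (↑(2 * π * ⟪h, ξ⟫_ℝ) * Complex.I) := by
    rw [← Complex.exp_add, inner_sub_right, real_inner_comm h ξ]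
    congr 1
    push_cast
    ring
  have h3 : (((cos (2 * π * ⟪h, ξ⟫_ℝ) : ℝ)) : ℂ) = (Complex.exp (↑(2 * π * ⟪h, ξ⟫_ℝ) * Complex.I)
      + Complex.exp (-(↑(2 * π * ⟪h, ξ⟫_ℝ) * Complex.I))) / 2 := by
    rw [Complex.ofReal_cos, Complex.cos, neg_mul]
  rw [h1, h2, Complex.ofReal_mul 2, Complex.ofReal_sub 1, Complex.ofReal_one,
    Complex.ofReal_ofNat, h3]
  ring

lemma ofReal_integral_secondDiff_eq_fourier [Nontrivial V] (hα0 : 0 < α) (hα2 : α < 2) {C : ℝ}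
    (hC : ∀ ξ : V, ∫ h : V, (1 - cos (2 * π * ⟪h, ξ⟫_ℝ)) * ‖h‖ ^ (-(finrank ℝ V + α))
      = C * ‖ξ‖ ^ α)
    (φ : 𝓢(V, ℝ)) (ψ : 𝓢(V, ℂ)) (hφψ : ∀ y, (φ y : ℂ) = 𝓕 (ψ : V → ℂ) y) (y : V) :
    ((2⁻¹ * ∫ h, secondDiff φ y h * ‖h‖ ^ (-(finrank ℝ V + α)) : ℝ) : ℂ)
      = 𝓕 (fun ξ => (‖ξ‖ ^ α) • (C * ψ ξ)) y := by
  have hψ2 : Integrable fun ξ : V => 20 * (1 + ‖ξ‖ ^ 2) * ‖ψ ξ‖ := by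
    have := ((ψ.integrable_pow_mul volume 0).add (ψ.integrable_pow_mul volume 2)).const_mul 20
    refine this.congr (ae_of_all _ fun ξ => ?_)
    simp only [Pi.add_apply]
    ring
  have hint : Integrable (Function.uncurry fun h ξ : V =>
      (((1 - cos (2 * π * ⟪h, ξ⟫_ℝ)) * ‖h‖ ^ (-(finrank ℝ V + α)) : ℝ) : ℂ) *
      (Complex.exp (↑(-2 * π * ⟪ξ, y⟫_ℝ) * Complex.I) * ψ ξ)) (volume.prod volume) := by
    refine ((integrable_min_sq_mul_rpow_norm hα0 hα2).mul_prod hψ2).mono' ?_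
      (ae_of_all _ fun p => ?_)
    · have h1 : Continuous fun p : V × V => 1 - cos (2 * π * ⟪p.1, p.2⟫_ℝ) := by fun_prop
      have h2 : Continuous fun p : V × V =>
          Complex.exp (↑(-2 * π * ⟪p.2, y⟫_ℝ) * Complex.I) * ψ p.2 := by
        have := ψ.continuous
        fun_prop
      exact ((Complex.measurable_ofReal.comp
        (h1.measurable.mul (measurable_fst.norm.pow_const _))).mul
          h2.measurable).aestronglyMeasurable
    · simp only [Function.uncurry]
      have h0 : 0 ≤ 1 - cos (2 * π * ⟪p.1, p.2⟫_ℝ) := sub_nonneg.2 (cos_le_one _)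
      rw [norm_mul, norm_mul, Complex.norm_exp_ofReal_mul_I, one_mul, Complex.norm_real,
        Real.norm_of_nonneg (by positivity)]
      calc _ ≤ (20 * (1 + ‖p.2‖ ^ 2) * min 1 (‖p.1‖ ^ 2)) * ‖p.1‖ ^ (-(finrank ℝ V + α))
            * ‖ψ p.2‖ := by
            gcongr
            exact one_sub_cos_inner_le _ _
        _ = _ := by ring
  have h1 : ∀ h : V, ((2⁻¹ * (secondDiff φ y h * ‖h‖ ^ (-(finrank ℝ V + α))) : ℝ) : ℂ)
      = ∫ ξ, (((1 - cos (2 * π * ⟪h, ξ⟫_ℝ)) * ‖h‖ ^ (-(finrank ℝ V + α)) : ℝ) : ℂ) *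
      (Complex.exp (↑(-2 * π * ⟪ξ, y⟫_ℝ) * Complex.I) * ψ ξ) := by
    intro h
    rw [Complex.ofReal_mul, Complex.ofReal_mul,
      ofReal_secondDiff_eq_integral φ ψ.integrable hφψ, mul_comm (integral _ _),
      ← integral_const_mul, ← integral_const_mul]
    congr 1
    ext ξ
    push_cast
    ring
  rw [← integral_const_mul, ← integral_complex_ofReal, integral_congr_ae (ae_of_all _ h1),
    integral_integral_swap hint, Real.fourier_eq']
  congr 1
  ext ξ
  rw [integral_mul_const, integral_complex_ofReal, hC, smul_eq_mul, Complex.real_smul]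
  push_cast
  ring

end FourierSide

section Riesz

variable {α : ℝ}

lemma integral_rpow_mul_exp_neg_mul_sq {a r : ℝ} (ha : 0 < a) (hr : 0 < r) :
    ∫ t in Set.Ioi 0, t ^ (a - 1) * exp (-(t * r ^ 2)) = r ^ (-(2 * a)) * Gamma a := by
  have := integral_rpow_mul_exp_neg_mul_Ioi ha (pow_pos hr 2)
  simp_rw [mul_comm _ (r ^ 2)]
  rw [this, one_div, inv_rpow (by positivity), ← rpow_natCast, ← rpow_mul hr.le, rpow_neg hr.le]
  norm_num

lemma integral_rpow_mul_exp_neg_div {b r : ℝ} (hb : 0 < b) (hr : 0 < r) :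
    ∫ t in Set.Ioi 0, t ^ (-b - 1) * exp (-(r / t)) = r ^ (-b) * Gamma b := by
  rw [rpow_neg hr.le, ← inv_rpow hr.le, ← one_div, ← integral_rpow_mul_exp_neg_mul_Ioi hb hr,
    ← integral_comp_rpow_Ioi _ (neg_ne_zero.2 one_ne_zero)]
  refine setIntegral_congr_fun measurableSet_Ioi fun t ht => ?_
  have ht0 : 0 < t := ht
  simp only [smul_eq_mul, abs_neg, abs_one, one_mul]
  rw [← mul_assoc, ← rpow_mul ht0.le, ← rpow_add ht0, rpow_neg_one, div_eq_mul_inv,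
    inv_inv]
  congr 2
  ring

lemma integrable_rpow_norm_smul {g : V → ℂ} [Nontrivial V] (hα0 : 0 < α) (hαd : α < finrank ℝ V)
    (hg : Integrable g) {B : ℝ} (hB : ∀ y, ‖g y‖ ≤ B) :
    Integrable fun y : V => ‖y‖ ^ (α - finrank ℝ V) • g y := by
  have hB0 : 0 ≤ B := (norm_nonneg _).trans (hB 0)
  have hmeas : AEStronglyMeasurable (fun y : V => ‖y‖ ^ (α - finrank ℝ V)) volume :=
    (measurable_norm.pow_const _).aestronglyMeasurable
  have hloc : Integrable fun y : V =>
      (Set.Ioo (0 : ℝ) 1).indicator (fun r => r ^ (α - finrank ℝ V)) ‖y‖ := by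
    have hd : 1 ≤ finrank ℝ V := finrank_pos
    rw [integrable_fun_norm_addHaar volume
      (f := (Set.Ioo (0 : ℝ) 1).indicator fun r => r ^ (α - finrank ℝ V))]
    have : (fun r : ℝ => r ^ (finrank ℝ V - 1) •
        (Set.Ioo (0 : ℝ) 1).indicator (fun r => r ^ (α - finrank ℝ V)) r)
        = (Set.Ioo (0 : ℝ) 1).indicator fun r => r ^ (α - 1) := by
      ext r
      simp only [Set.indicator_apply, smul_eq_mul]
      split_ifs with hr
      · rw [← rpow_natCast, ← rpow_add hr.1]
        congr 1
        push_cast [Nat.cast_sub hd]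
        ring
      · simp
    rw [this]
    refine Integrable.integrableOn ?_
    rw [integrable_indicator_iff measurableSet_Ioo]
    exact (intervalIntegral.integrableOn_Ioo_rpow_iff one_pos).2 (by linarith)
  refine ((hloc.const_mul B).add hg.norm).mono' (hmeas.smul hg.aestronglyMeasurable) ?_
  have h0 : ∀ᵐ y : V, y ≠ 0 := by simp [ae_iff]
  filter_upwards [h0] with y hy
  have hy0 : 0 < ‖y‖ := norm_pos_iff.2 hy
  rw [norm_smul, Real.norm_of_nonneg (by positivity), Pi.add_apply]
  rcases lt_or_ge ‖y‖ 1 with h1 | h1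
  · rw [Set.indicator_of_mem (show ‖y‖ ∈ Set.Ioo (0 : ℝ) 1 from ⟨hy0, h1⟩), mul_comm B]
    have := hB y
    exact (mul_le_mul_of_nonneg_left this (by positivity)).trans
      (le_add_of_nonneg_right (norm_nonneg _))
  · rw [Set.indicator_of_notMem (fun h => h1.not_gt h.2), mul_zero, zero_add]
    exact mul_le_of_le_one_left (norm_nonneg _)
      (rpow_le_one_of_one_le_of_nonpos h1 (by linarith))

lemma integral_exp_neg_mul_sq_smul_fourier {t : ℝ} (ht : 0 < t) {f : V → ℂ} (hf : Integrable f) :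
    ∫ y : V, exp (-(t * ‖y‖ ^ 2)) • 𝓕 f y
      = ∫ ξ : V, ((π / t) ^ ((finrank ℝ V : ℝ) / 2) * exp (-(π ^ 2 * ‖ξ‖ ^ 2 / t))) • f ξ := by
  have ht' : 0 < (t : ℂ).re := by simpa using ht
  have hgauss : Integrable fun y : V => Complex.exp (-(t : ℂ) * ‖y‖ ^ 2) := by
    simpa using! GaussianFourier.integrable_cexp_neg_mul_sq_norm_add ht' 0 (0 : V)
  have h := VectorFourier.integral_fourierIntegral_smul_eq_flip (L := innerₗ V)
    (μ := volume) (ν := volume) Real.continuous_fourierChar continuous_inner hgauss hf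
  have hexp : ∀ y : V, Complex.exp (-(t : ℂ) * ‖y‖ ^ 2) = (exp (-(t * ‖y‖ ^ 2)) : ℝ) := by
    intro y
    push_cast
    ring_nf
  have hcpow : (π / t : ℂ) ^ ((finrank ℝ V : ℂ) / 2)
      = ((π / t) ^ ((finrank ℝ V : ℝ) / 2) : ℝ) := by
    rw [Complex.ofReal_cpow (by positivity)]
    push_cast
    rfl
  have hF : ∀ ξ : V, VectorFourier.fourierIntegral 𝐞 volume (innerₗ V)
      (fun y : V => Complex.exp (-(t : ℂ) * ‖y‖ ^ 2)) ξ
      = (((π / t) ^ ((finrank ℝ V : ℝ) / 2) * exp (-(π ^ 2 * ‖ξ‖ ^ 2 / t)) : ℝ) : ℂ) := by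
    intro ξ
    refine (fourier_gaussian_innerProductSpace ht' ξ).trans ?_
    rw [hcpow]
    push_cast
    ring_nf
  simp only [flip_innerₗ, hF] at h
  simp only [hexp, Complex.coe_smul] at h
  exact h.symm

/-- Pairing the Riesz kernel with the Fourier transform of `‖ξ‖ ^ α • w` recovers a positive
multiple of `∫ w`. -/
lemma integral_rpow_norm_smul_fourier [Nontrivial V] (hα0 : 0 < α) (hαd : α < finrank ℝ V)
    {w : V → ℂ} (hw : Integrable w) (hαw : Integrable fun ξ => ‖ξ‖ ^ α • w ξ)
    (hg : Integrable (𝓕 fun ξ => ‖ξ‖ ^ α • w ξ)) :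
    Gamma ((finrank ℝ V - α) / 2) • ∫ y : V, ‖y‖ ^ (α - finrank ℝ V) • 𝓕 (fun ξ => ‖ξ‖ ^ α • w ξ) y
      = (π ^ ((finrank ℝ V : ℝ) / 2) * (π ^ (-α) * Gamma (α / 2))) • ∫ ξ, w ξ := by
  set a := (finrank ℝ V - α) / 2 with ha
  have ha0 : 0 < a := by linarith
  set g := 𝓕 fun ξ => ‖ξ‖ ^ α • w ξ with hgdef
  have hB : ∀ y, ‖g y‖ ≤ ∫ ξ, ‖‖ξ‖ ^ α • w ξ‖ := fun y =>
    VectorFourier.norm_fourierIntegral_le_integral_norm _ _ _ _ _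
  have h0 : ∀ᵐ y : V, y ≠ 0 := by simp [ae_iff]
  have hK1 : ∀ y : V, y ≠ 0 → ∫ t in Set.Ioi 0, t ^ (a - 1) * exp (-(t * ‖y‖ ^ 2))
      = Gamma a * ‖y‖ ^ (α - finrank ℝ V) := by
    intro y hy
    rw [integral_rpow_mul_exp_neg_mul_sq ha0 (norm_pos_iff.2 hy), mul_comm]
    congr 2
    rw [ha]
    ring
  have hK2 : ∀ ξ : V, ξ ≠ 0 →
      ∫ t in Set.Ioi 0, t ^ (-(α / 2) - 1) * exp (-(π ^ 2 * ‖ξ‖ ^ 2 / t))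
      = π ^ (-α) * Gamma (α / 2) * ‖ξ‖ ^ (-α) := by
    intro ξ hξ
    have hξ0 := norm_pos_iff.2 hξ
    rw [integral_rpow_mul_exp_neg_div (by positivity) (by positivity), ← mul_pow, ← rpow_natCast,
      ← rpow_mul (by positivity), mul_rpow pi_pos.le hξ0.le]
    have : ((2 : ℕ) : ℝ) * -(α / 2) = -α := by push_cast; ring
    rw [this]
    ring
  have hint1 : Integrable (Function.uncurry fun (y : V) (t : ℝ) =>
      (t ^ (a - 1) * exp (-(t * ‖y‖ ^ 2))) • g y)
      (volume.prod (volume.restrict (Set.Ioi 0))) := by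
    have hk : Measurable fun p : V × ℝ => p.2 ^ (a - 1) * exp (-(p.2 * ‖p.1‖ ^ 2)) :=
      (measurable_snd.pow_const _).mul (by fun_prop)
    refine (integrable_prod_iff (hk.aestronglyMeasurable.smul
      hg.aestronglyMeasurable.comp_fst)).2 ⟨?_, ?_⟩
    · filter_upwards [h0] with y hy
      have : Integrable (fun t => t ^ (a - 1) * exp (-(t * ‖y‖ ^ 2)))
          (volume.restrict (Set.Ioi 0)) := by
        refine Integrable.of_integral_ne_zero ?_
        rw [hK1 y hy]
        exact (mul_pos (Gamma_pos_of_pos ha0) (rpow_pos_of_pos (norm_pos_iff.2 hy) _)).ne'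
      exact this.smul_const (g y)
    · refine ((integrable_rpow_norm_smul hα0 hαd hg hB).norm.const_mul (Gamma a)).congr ?_
      filter_upwards [h0] with y hy
      have : ∀ t ∈ Set.Ioi (0 : ℝ), ‖(t ^ (a - 1) * exp (-(t * ‖y‖ ^ 2))) • g y‖
          = t ^ (a - 1) * exp (-(t * ‖y‖ ^ 2)) * ‖g y‖ := fun t ht => by
        have ht0 : (0 : ℝ) < t := ht
        rw [norm_smul, Real.norm_of_nonneg (by positivity)]
      refine Eq.trans ?_ (setIntegral_congr_fun measurableSet_Ioi this).symm
      rw [integral_mul_const, hK1 y hy, norm_smul,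
        Real.norm_of_nonneg (by positivity)]
      ring
  have hint2 : Integrable (Function.uncurry fun (ξ : V) (t : ℝ) =>
      (t ^ (-(α / 2) - 1) * exp (-(π ^ 2 * ‖ξ‖ ^ 2 / t))) • (‖ξ‖ ^ α • w ξ))
      (volume.prod (volume.restrict (Set.Ioi 0))) := by
    have hk : Measurable fun p : V × ℝ =>
        p.2 ^ (-(α / 2) - 1) * exp (-(π ^ 2 * ‖p.1‖ ^ 2 / p.2)) :=
      (measurable_snd.pow_const _).mul (by fun_prop)
    refine (integrable_prod_iff (hk.aestronglyMeasurable.smul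
      hαw.aestronglyMeasurable.comp_fst)).2 ⟨?_, ?_⟩
    · filter_upwards [h0] with ξ hξ
      have : Integrable (fun t => t ^ (-(α / 2) - 1) * exp (-(π ^ 2 * ‖ξ‖ ^ 2 / t)))
          (volume.restrict (Set.Ioi 0)) := by
        refine Integrable.of_integral_ne_zero ?_
        rw [hK2 ξ hξ]
        have := norm_pos_iff.2 hξ
        have := Gamma_pos_of_pos (half_pos hα0)
        positivity
      exact this.smul_const (‖ξ‖ ^ α • w ξ)
    · refine (hw.norm.const_mul (π ^ (-α) * Gamma (α / 2))).congr ?_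
      filter_upwards [h0] with ξ hξ
      have hξ0 := norm_pos_iff.2 hξ
      have : ∀ t ∈ Set.Ioi (0 : ℝ),
          ‖(t ^ (-(α / 2) - 1) * exp (-(π ^ 2 * ‖ξ‖ ^ 2 / t))) • (‖ξ‖ ^ α • w ξ)‖
          = t ^ (-(α / 2) - 1) * exp (-(π ^ 2 * ‖ξ‖ ^ 2 / t)) * (‖ξ‖ ^ α * ‖w ξ‖) := fun t ht => by
        have ht0 : (0 : ℝ) < t := ht
        rw [norm_smul, norm_smul, Real.norm_of_nonneg (by positivity),
          Real.norm_of_nonneg (by positivity)]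
      refine Eq.trans ?_ (setIntegral_congr_fun measurableSet_Ioi this).symm
      rw [integral_mul_const, hK2 ξ hξ,
        rpow_neg hξ0.le]
      field_simp
  have hL : Gamma a • ∫ y : V, ‖y‖ ^ (α - finrank ℝ V) • g y
      = ∫ t in Set.Ioi 0, ∫ y, (t ^ (a - 1) * exp (-(t * ‖y‖ ^ 2))) • g y := by
    rw [← integral_integral_swap hint1, ← integral_smul]
    refine integral_congr_ae ?_
    filter_upwards [h0] with y hy
    rw [integral_smul_const, hK1 y hy, mul_smul]
  have hR : (π ^ (-α) * Gamma (α / 2)) • ∫ ξ, w ξ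
      = ∫ t in Set.Ioi 0, ∫ ξ, (t ^ (-(α / 2) - 1) * exp (-(π ^ 2 * ‖ξ‖ ^ 2 / t))) •
        (‖ξ‖ ^ α • w ξ) := by
    rw [← integral_integral_swap hint2, ← integral_smul]
    refine integral_congr_ae ?_
    filter_upwards [h0] with ξ hξ
    have hξ0 := norm_pos_iff.2 hξ
    rw [integral_smul_const, hK2 ξ hξ, smul_smul, mul_assoc _ (‖ξ‖ ^ (-α)), ← rpow_add hξ0]
    simp
  rw [hL, mul_smul, hR, ← integral_smul]
  refine setIntegral_congr_fun measurableSet_Ioi fun t ht => ?_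
  have ht0 : (0 : ℝ) < t := ht
  simp only [mul_smul]
  rw [integral_smul, hgdef, integral_exp_neg_mul_sq_smul_fourier ht0 hαw, integral_smul,
    ← integral_smul, ← integral_smul, ← integral_smul]
  congr 1
  ext ξ
  simp only [smul_smul]
  congr 1
  rw [div_rpow pi_pos.le ht0.le, div_eq_mul_inv, ← rpow_neg ht0.le]
  have : t ^ (-(α / 2) - 1) = t ^ (a - 1) * t ^ (-((finrank ℝ V : ℝ) / 2)) := by
    rw [← rpow_add ht0]
    congr 1
    rw [ha]
    ring
  rw [this]
  ring

end Riesz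

/-- The constant relating the Riesz kernel and the principal-value fractional Laplacian, given the
constant `C` of the Lévy symbol. -/
lemma exists_integral_rpow_norm_mul_eq [Nontrivial V] {α : ℝ} (hα0 : 0 < α) (hα2 : α < 2)
    (hαd : α < finrank ℝ V) :
    ∃ c : ℝ, 0 < c ∧ ∀ (φ : 𝓢(V, ℝ)) (g : V → ℝ),
      (∀ y, g y = 2⁻¹ * ∫ h, secondDiff φ y h * ‖h‖ ^ (-(finrank ℝ V + α))) →
      ∫ y : V, ‖y‖ ^ (α - finrank ℝ V) * g y = c * φ 0 := by
  obtain ⟨C, hC0, hC⟩ := exists_integral_one_sub_cos_eq (V := V) hα0 hα2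
  have hG : 0 < Gamma ((finrank ℝ V - α) / 2) := Gamma_pos_of_pos (by linarith)
  have hG' : 0 < Gamma (α / 2) := Gamma_pos_of_pos (by linarith)
  refine ⟨(π ^ ((finrank ℝ V : ℝ) / 2) * (π ^ (-α) * Gamma (α / 2))) * C
    / Gamma ((finrank ℝ V - α) / 2), by positivity, fun φ g hg => ?_⟩
  set φc : 𝓢(V, ℂ) := SchwartzMap.postcompCLM (𝕜 := ℝ) Complex.ofRealCLM φ
  set ψ : 𝓢(V, ℂ) := 𝓕⁻ φc
  have hφψ : ∀ y, (φ y : ℂ) = 𝓕 (ψ : V → ℂ) y := by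
    intro y
    rw [← SchwartzMap.fourier_coe, FourierTransform.fourier_fourierInv_eq]
    rfl
  have hgF : (fun y => (g y : ℂ)) = 𝓕 fun ξ => (‖ξ‖ ^ α) • (C * ψ ξ) := by
    ext y
    rw [hg y, ofReal_integral_secondDiff_eq_fourier hα0 hα2 hC φ ψ hφψ y]
  have hgint : Integrable fun y => (g y : ℂ) := by
    refine Integrable.ofReal ?_
    simp only [funext hg]
    exact (integrable_uncurry_secondDiff_mul_rpow_norm φ hα0 hα2).integral_prod_left.const_mul _
  have hw : Integrable fun ξ => C * ψ ξ := ψ.integrable.const_mul _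
  have hαw : Integrable fun ξ : V => ‖ξ‖ ^ α • (C * ψ ξ) := by
    have hd := ((ψ.integrable_pow_mul volume 0).add (ψ.integrable_pow_mul volume 2)).const_mul C
    have hc : Continuous fun ξ : V => ‖ξ‖ ^ α • (C * ψ ξ) := by
      have := ψ.continuous
      exact (continuous_norm.rpow_const fun _ => Or.inr hα0.le).smul (by fun_prop)
    refine hd.mono' hc.aestronglyMeasurable (ae_of_all _ fun ξ => ?_)
    have hle : ‖ξ‖ ^ α ≤ 1 + ‖ξ‖ ^ 2 := by
      rcases le_total ‖ξ‖ 1 with h | h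
      · linarith [rpow_le_one (norm_nonneg ξ) h hα0.le, sq_nonneg ‖ξ‖]
      · have := rpow_le_rpow_of_exponent_le h hα2.le
        rw [rpow_two] at this
        linarith
    rw [norm_smul, norm_mul, Complex.norm_real, Real.norm_of_nonneg hC0.le,
      Real.norm_of_nonneg (by positivity)]
    calc _ ≤ (1 + ‖ξ‖ ^ 2) * (C * ‖ψ ξ‖) := by gcongr
      _ = _ := by simp only [Pi.add_apply]; ring
  have key := integral_rpow_norm_smul_fourier hα0 hαd hw hαw (hgF ▸ hgint)
  have h0 : ∫ ξ, C * ψ ξ = C * φ 0 := by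
    rw [integral_const_mul, hφψ, Real.fourier_eq']
    simp
  rw [← hgF, h0] at key
  have hreal : ∫ y : V, ‖y‖ ^ (α - finrank ℝ V) • (g y : ℂ)
      = ((∫ y : V, ‖y‖ ^ (α - finrank ℝ V) * g y : ℝ) : ℂ) := by
    rw [← integral_complex_ofReal]
    simp
  rw [hreal, Complex.real_smul, Complex.real_smul] at key
  norm_cast at key
  rw [div_mul_eq_mul_div, eq_div_iff hG.ne']
  linarith

end RieszKernel

/-- The Riesz kernel `|x-y|^{α-n}` is, up to a positive constant, the fundamental
solution of the fractional Laplacian: there is `c_{n,α} > 0` such that for every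
Schwartz `φ` and every `x`, `∫ |x-y|^{α-n} · ((-Δ)^{α/2}φ)(y) dy = c_{n,α} φ(x)`,
where `((-Δ)^{α/2}φ)(y)` is the principal-value integral. -/
theorem riesz_kernel_fundamental_solution (n : ℕ) (hn : 1 ≤ n) (α : ℝ)
    (hα0 : 0 < α) (hα2 : α < 2) (hαn : α < n) :
    ∃ c : ℝ, 0 < c ∧
      ∀ φ : SchwartzMap (EuclideanSpace ℝ (Fin n)) ℝ,
        ∀ g : EuclideanSpace ℝ (Fin n) → ℝ,
          (∀ y, IsFracLapAt n α (fun w => φ w) y (g y)) →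
          ∀ x : EuclideanSpace ℝ (Fin n),
            ∫ y : EuclideanSpace ℝ (Fin n), ‖x - y‖ ^ (α - (n : ℝ)) * g y = c * φ x := by
  have : Nonempty (Fin n) := ⟨⟨0, hn⟩⟩
  have hd : finrank ℝ (EuclideanSpace ℝ (Fin n)) = n := finrank_euclideanSpace_fin
  obtain ⟨c, hc0, hc⟩ := RieszKernel.exists_integral_rpow_norm_mul_eq
    (V := EuclideanSpace ℝ (Fin n)) hα0 hα2 (by rwa [hd])
  refine ⟨c, hc0, fun φ g hg x => ?_⟩
  have h := hc (SchwartzMap.compSubConstCLM ℝ (-x) φ) (fun y => g (y + x)) fun y => by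
    have hy := hg (y + x)
    rw [IsFracLapAt] at hy
    rw [RieszKernel.eq_integral_secondDiff_of_tendsto φ hα0 hα2 (L := g (y + x)) (y := y + x)
      (by rwa [hd])]
    simp only [RieszKernel.secondDiff, SchwartzMap.compSubConstCLM_apply, sub_neg_eq_add]
    simp only [add_right_comm, sub_add_eq_add_sub]
  rw [← integral_add_right_eq_self _ x]
  simpa [norm_sub_rev, hd] using h
end
end
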